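/- arXiv:1704.00955 — 2 statements merged into one kernel-verified Lean document; each statement's English description precedes it below -/
import Mathlib

section
/- Diagonal trace estimate with fractional derivatives for the free two-variable Schrödinger flow: for every 0 < ε < 1 there is a constant C = C(ε) such that for all Schwartz Λ₀ on ℝ², the solution Λ(t) = e^{it(Δ_x+Δ_y)}Λ₀ satisfies ‖ |∇_x|^{ε} (Λ(t,x,x)) ‖_{L⁴(dt)L²(dx)} ≤ C ‖ |∇_{x+y}|^{ε} Λ₀ ‖_{L²(ℝ²)}, where |∇_x|^ε acts on the function x ↦ Λ(t,x,x). -/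
open MeasureTheory Complex SchwartzMap
open scoped ENNReal NNReal Real

noncomputable section

/-- 1D Fourier transform with the convention `f̂ ξ = ∫ e^{-iξx} f x dx`. -/
def FT1 (f : ℝ → ℂ) (ξ : ℝ) : ℂ :=
  ∫ x : ℝ, Complex.exp (-(Complex.I) * (ξ : ℂ) * (x : ℂ)) * f x

/-- 1D inverse Fourier transform. -/
def IFT1 (g : ℝ → ℂ) (x : ℝ) : ℂ :=
  (2 * (Real.pi : ℂ))⁻¹ * ∫ ξ : ℝ, Complex.exp (Complex.I * (ξ : ℂ) * (x : ℂ)) * g ξ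

/-- 2D Fourier transform (curried kernels). -/
def FT2 (f : ℝ → ℝ → ℂ) (ξ η : ℝ) : ℂ :=
  ∫ x : ℝ, ∫ y : ℝ, Complex.exp (-(Complex.I) * ((ξ : ℂ) * x + (η : ℂ) * y)) * f x y

/-- 2D inverse Fourier transform. -/
def IFT2 (g : ℝ → ℝ → ℂ) (x y : ℝ) : ℂ :=
  ((2 * (Real.pi : ℂ)) ^ 2)⁻¹ *
    ∫ ξ : ℝ, ∫ η : ℝ, Complex.exp (Complex.I * ((ξ : ℂ) * x + (η : ℂ) * y)) * g ξ η

/-- Free propagator `e^{it(Δ_x − Δ_y)}`, Fourier multiplier `e^{it(η²−ξ²)}`. -/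
def freeGamma (Γ₀ : ℝ → ℝ → ℂ) (t x y : ℝ) : ℂ :=
  IFT2 (fun ξ η => Complex.exp (Complex.I * (t : ℂ) * ((η : ℂ) ^ 2 - (ξ : ℂ) ^ 2)) * FT2 Γ₀ ξ η) x y

/-- Free propagator `e^{it(Δ_x + Δ_y)}`, Fourier multiplier `e^{−it(ξ²+η²)}`. -/
def freeLambda (Λ₀ : ℝ → ℝ → ℂ) (t x y : ℝ) : ℂ :=
  IFT2 (fun ξ η => Complex.exp (-(Complex.I) * (t : ℂ) * ((ξ : ℂ) ^ 2 + (η : ℂ) ^ 2)) * FT2 Λ₀ ξ η) x y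

/-- `|∇_x|^s`, Fourier multiplier `|ξ|^s` in one variable. -/
def absDx (s : ℝ) (f : ℝ → ℂ) (x : ℝ) : ℂ :=
  IFT1 (fun ξ => ((|ξ| ^ s : ℝ) : ℂ) * FT1 f ξ) x

/-- `|∇_{x,y}|^s`, Fourier multiplier `(ξ²+η²)^{s/2}` on `ℝ²`. -/
def absDxy (s : ℝ) (f : ℝ → ℝ → ℂ) (x y : ℝ) : ℂ :=
  IFT2 (fun ξ η => (((ξ ^ 2 + η ^ 2) ^ (s / 2) : ℝ) : ℂ) * FT2 f ξ η) x y

/-- `|∇_{x+y}|^s`, Fourier multiplier `(|ξ+η|/2)^s` on `ℝ²`. -/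
def absDxpy (s : ℝ) (f : ℝ → ℝ → ℂ) (x y : ℝ) : ℂ :=
  IFT2 (fun ξ η => (((|ξ + η| / 2) ^ s : ℝ) : ℂ) * FT2 f ξ η) x y

/-- `⟨∇_x⟩^s`, Fourier multiplier `(1+ξ²)^{s/2}` in one variable. -/
def japDx (s : ℝ) (f : ℝ → ℂ) (x : ℝ) : ℂ :=
  IFT1 (fun ξ => (((1 + ξ ^ 2) ^ (s / 2) : ℝ) : ℂ) * FT1 f ξ) x

/-- `⟨∇_{x,y}⟩^s`, Fourier multiplier `(1+ξ²+η²)^{s/2}` on `ℝ²`. -/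
def japDxy (s : ℝ) (f : ℝ → ℝ → ℂ) (x y : ℝ) : ℂ :=
  IFT2 (fun ξ η => (((1 + ξ ^ 2 + η ^ 2) ^ (s / 2) : ℝ) : ℂ) * FT2 f ξ η) x y

/-- `L²` norm of a kernel on `ℝ²`. -/
def L2K (f : ℝ → ℝ → ℂ) : ℝ≥0∞ :=
  eLpNorm (fun p : ℝ × ℝ => f p.1 p.2) 2 volume

/-- `L²` norm on `ℝ`. -/
def L2F (f : ℝ → ℂ) : ℝ≥0∞ := eLpNorm f 2 volume

/-- Mixed norm `L^q(μ(dt)) L^r(dx)` for a function of `(t,x)`. -/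
def MixedN2 (μ : Measure ℝ) (q r : ℝ≥0∞) (u : ℝ → ℝ → ℂ) : ℝ≥0∞ :=
  eLpNorm (fun t => (eLpNorm (u t) r volume).toReal) q μ

/-- Mixed norm `L^q(μ(dt)) L^r(dx) L^s(dy)` for a function of `(t,x,y)`. -/
def MixedN3 (μ : Measure ℝ) (q r s : ℝ≥0∞) (u : ℝ → ℝ → ℝ → ℂ) : ℝ≥0∞ :=
  eLpNorm (fun t => (eLpNorm (fun x => (eLpNorm (u t x) s volume).toReal) r volume).toReal) q μ

/-- Spacetime Fourier transform on `ℝ_t × ℝ_x`. -/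
def FTtx (u : ℝ → ℝ → ℂ) (τ ξ : ℝ) : ℂ :=
  ∫ t : ℝ, ∫ x : ℝ, Complex.exp (-(Complex.I) * ((τ : ℂ) * t + (ξ : ℂ) * x)) * u t x

/-- Spacetime Fourier transform on `ℝ_t × ℝ²`. -/
def FTtxy (u : ℝ → ℝ → ℝ → ℂ) (τ ξ η : ℝ) : ℂ :=
  ∫ t : ℝ, ∫ x : ℝ, ∫ y : ℝ,
    Complex.exp (-(Complex.I) * ((τ : ℂ) * t + (ξ : ℂ) * x + (η : ℂ) * y)) * u t x y

/-- Bourgain space norm `X^b` associated to `𝐒 = (1/i)∂_t − Δ_x − Δ_y`. -/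
def XbNorm (b : ℝ) (u : ℝ → ℝ → ℝ → ℂ) : ℝ≥0∞ :=
  eLpNorm (fun p : ℝ × ℝ × ℝ =>
    (((1 + |p.1 + p.2.1 ^ 2 + p.2.2 ^ 2|) ^ b : ℝ) : ℂ) * FTtxy u p.1 p.2.1 p.2.2) 2 volume

/-- Duhamel solution of `𝐒_± Γ = F` with data `Γ₀`. -/
def duhamelGamma (Γ₀ : ℝ → ℝ → ℂ) (F : ℝ → ℝ → ℝ → ℂ) (t x y : ℝ) : ℂ :=
  freeGamma Γ₀ t x y + Complex.I * ∫ s in (0:ℝ)..t, freeGamma (F s) (t - s) x y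

/-- Duhamel solution of `𝐒 Λ = F` with data `Λ₀`. -/
def duhamelLambda (Λ₀ : ℝ → ℝ → ℂ) (F : ℝ → ℝ → ℝ → ℂ) (t x y : ℝ) : ℂ :=
  freeLambda Λ₀ t x y + Complex.I * ∫ s in (0:ℝ)..t, freeLambda (F s) (t - s) x y

open FourierTransform
open scoped ContDiff

theorem integral_schwartz_mul_fourier {h : ℝ → ℂ} (hh : Integrable h) (φ : 𝓢(ℝ, ℂ)) :
    ∫ x, φ x • 𝓕 h x = ∫ x, (𝓕 φ) x • h x := by
  have := VectorFourier.integral_fourierIntegral_smul_eq_flip (e := Real.fourierChar)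
    (L := innerₗ ℝ) (μ := volume) (ν := volume) (f := ⇑φ) (g := h)
    Real.continuous_fourierChar (by fun_prop) φ.integrable hh
  rw [flip_innerₗ] at this
  exact this.symm

theorem eq_of_integral_schwartz {f g : ℝ → ℂ} (hf : LocallyIntegrable f) (hg : LocallyIntegrable g)
    (h : ∀ φ : 𝓢(ℝ, ℂ), ∫ x, φ x • f x = ∫ x, φ x • g x) : f =ᵐ[volume] g := by
  refine ae_eq_of_integral_contDiff_smul_eq hf hg fun u u_smooth u_cpt => ?_
  have hg₁ : HasCompactSupport (Complex.ofRealCLM ∘ u) := u_cpt.comp_left rfl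
  have hg₂ : ContDiff ℝ ∞ (Complex.ofRealCLM ∘ u) := by fun_prop
  simpa using h (hg₁.toSchwartzMap hg₂)

theorem continuous_fourier {h : ℝ → ℂ} (hh : Integrable h) : Continuous (𝓕 h) :=
  VectorFourier.fourierIntegral_continuous Real.continuous_fourierChar (by fun_prop) hh

theorem eLpNorm_fourier_eq {h : ℝ → ℂ} (hh : Integrable h) (h2 : MemLp h 2) :
    eLpNorm (𝓕 h) 2 = eLpNorm h 2 := by
  have key : 𝓕 h =ᵐ[volume] (𝓕 (h2.toLp h) : Lp ℂ 2 (volume : Measure ℝ)) := by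
    refine eq_of_integral_schwartz (continuous_fourier hh).locallyIntegrable
      ((Lp.memLp _).locallyIntegrable (by norm_num)) fun φ => ?_
    rw [integral_schwartz_mul_fourier hh, ← Lp.toTemperedDistribution_apply,
      ← Lp.fourier_toTemperedDistribution_eq, TemperedDistribution.fourier_apply,
      Lp.toTemperedDistribution_apply]
    refine integral_congr_ae ?_
    filter_upwards [h2.coeFn_toLp] with x hx
    rw [hx]
  rw [eLpNorm_congr_ae key, ← Lp.enorm_def, ← eLpNorm_congr_ae h2.coeFn_toLp, ← Lp.enorm_def]
  rw [← ofReal_norm, ← ofReal_norm, Lp.norm_fourier_eq]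

theorem eLpNorm_eq_eLpNorm_fourier {h : ℝ → ℂ} (hh : Integrable h) (h2 : MemLp (𝓕 h) 2) :
    eLpNorm h 2 = eLpNorm (𝓕 h) 2 := by
  have key : h =ᵐ[volume] (𝓕⁻ (h2.toLp (𝓕 h)) : Lp ℂ 2 (volume : Measure ℝ)) := by
    refine eq_of_integral_schwartz hh.locallyIntegrable
      ((Lp.memLp _).locallyIntegrable (by norm_num)) fun φ => ?_
    rw [← Lp.toTemperedDistribution_apply,
      ← Lp.fourierInv_toTemperedDistribution_eq, TemperedDistribution.fourierInv_apply,
      Lp.toTemperedDistribution_apply]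
    trans ∫ x, (𝓕⁻ φ) x • 𝓕 h x
    · rw [integral_schwartz_mul_fourier hh]; simp
    refine integral_congr_ae ?_
    filter_upwards [h2.coeFn_toLp] with x hx
    rw [hx]
  rw [eLpNorm_congr_ae key, ← Lp.enorm_def, ← eLpNorm_congr_ae h2.coeFn_toLp, ← Lp.enorm_def]
  rw [← ofReal_norm, ← ofReal_norm, ← Lp.norm_fourier_eq]
  simp

theorem eLpNorm_two_sq {α : Type*} [MeasurableSpace α] {μ : Measure α} (f : α → ℂ) :
    eLpNorm f 2 μ ^ 2 = ∫⁻ x, ‖f x‖ₑ ^ 2 ∂μ := by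
  rw [eLpNorm_eq_lintegral_rpow_enorm_toReal (by norm_num) (by norm_num)]
  rw [← ENNReal.rpow_natCast, ← ENNReal.rpow_mul]
  simp

theorem lintegral_fourier_sq_le (h : ℝ → ℂ) : ∫⁻ x, ‖𝓕 h x‖ₑ ^ 2 ≤ ∫⁻ x, ‖h x‖ₑ ^ 2 := by
  by_cases hh : Integrable h
  · rw [← eLpNorm_two_sq, ← eLpNorm_two_sq]
    rcases eq_or_ne (eLpNorm h 2) ⊤ with ht | ht
    · simp [ht]
    · rw [eLpNorm_fourier_eq hh ⟨hh.1, ht.lt_top⟩]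
  · have : 𝓕 h = 0 := by
      ext x
      rw [Real.fourier_eq]
      refine integral_undef fun hi => hh ?_
      exact (Real.fourierIntegral_convergent_iff x).1 hi
    simp [this]

theorem le_lintegral_fourier_sq {h : ℝ → ℂ} (hh : Integrable h) :
    ∫⁻ x, ‖h x‖ₑ ^ 2 ≤ ∫⁻ x, ‖𝓕 h x‖ₑ ^ 2 := by
  rw [← eLpNorm_two_sq, ← eLpNorm_two_sq]
  rcases eq_or_ne (eLpNorm (𝓕 h) 2) ⊤ with ht | ht
  · simp [ht]
  · rw [eLpNorm_eq_eLpNorm_fourier hh ⟨(continuous_fourier hh).aestronglyMeasurable, ht.lt_top⟩]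

theorem lintegral_comp_mul_left_real {a : ℝ} (ha : a ≠ 0) (f : ℝ → ℝ≥0∞) :
    ∫⁻ x, f (a * x) = ENNReal.ofReal |a⁻¹| * ∫⁻ x, f x := by
  rw [← smul_eq_mul, ← lintegral_smul_measure, ← Real.map_volume_mul_left ha,
    show (fun x : ℝ => a * x) = Homeomorph.mulLeft₀ a ha from rfl,
    (Homeomorph.mulLeft₀ a ha).measurableEmbedding.lintegral_map]
  rfl

theorem IFT1_eq_fourier (h : ℝ → ℂ) (x : ℝ) :
    IFT1 h x = (2 * (π : ℂ))⁻¹ * 𝓕 h (-(2 * π)⁻¹ * x) := by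
  rw [IFT1, Real.fourier_real_eq_integral_exp_smul]
  congr 2 with v
  rw [smul_eq_mul]
  congr 2
  push_cast
  field_simp

theorem lintegral_IFT1_sq (h : ℝ → ℂ) :
    ∫⁻ x, ‖IFT1 h x‖ₑ ^ 2 = ENNReal.ofReal (2 * π)⁻¹ * ∫⁻ x, ‖𝓕 h x‖ₑ ^ 2 := by
  have hpi := Real.pi_pos
  have hc : ‖(2 * (π : ℂ))⁻¹‖ₑ = ENNReal.ofReal (2 * π)⁻¹ := by
    rw [← ofReal_norm]
    congr 1
    simp [abs_of_pos hpi]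
  simp_rw [IFT1_eq_fourier, enorm_mul, mul_pow, hc]
  rw [lintegral_const_mul' _ _ (by finiteness),
    lintegral_comp_mul_left_real (a := -(2 * π)⁻¹) (by simp [hpi.ne']) (fun x => ‖𝓕 h x‖ₑ ^ 2),
    ← mul_assoc]
  congr 1
  rw [← ENNReal.ofReal_pow (by positivity), ← ENNReal.ofReal_mul (by positivity)]
  congr 1
  rw [inv_neg, abs_neg, inv_inv, abs_of_pos (by positivity)]
  field_simp

theorem lintegral_IFT1_sq_le (h : ℝ → ℂ) :
    ∫⁻ x, ‖IFT1 h x‖ₑ ^ 2 ≤ ENNReal.ofReal (2 * π)⁻¹ * ∫⁻ x, ‖h x‖ₑ ^ 2 := by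
  rw [lintegral_IFT1_sq]
  exact mul_le_mul_right (lintegral_fourier_sq_le h) _

theorem le_lintegral_IFT1_sq {h : ℝ → ℂ} (hh : Integrable h) :
    ENNReal.ofReal (2 * π)⁻¹ * ∫⁻ x, ‖h x‖ₑ ^ 2 ≤ ∫⁻ x, ‖IFT1 h x‖ₑ ^ 2 := by
  rw [lintegral_IFT1_sq]
  exact mul_le_mul_right (le_lintegral_fourier_sq hh) _

theorem enorm_integral_sq_le {α : Type*} [MeasurableSpace α] (μ : Measure α) {u : α → ℂ}
    (hu : AEStronglyMeasurable u μ) :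
    ‖∫ x, u x ∂μ‖ₑ ^ 2 ≤ μ Set.univ * ∫⁻ x, ‖u x‖ₑ ^ 2 ∂μ := by
  have h1 := eLpNorm_le_eLpNorm_mul_rpow_measure_univ (p := 1) (q := 2) (by norm_num) hu
  have h2 : ‖∫ x, u x ∂μ‖ₑ ≤ eLpNorm u 1 μ := by
    rw [eLpNorm_one_eq_lintegral_enorm]
    exact enorm_integral_le_lintegral_enorm u
  calc _ ≤ (eLpNorm u 2 μ * μ Set.univ ^ (1 / (1 : ℝ≥0∞).toReal - 1 / (2 : ℝ≥0∞).toReal)) ^ 2 := by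
        gcongr; exact h2.trans h1
    _ = _ := by
        rw [mul_pow, eLpNorm_two_sq, mul_comm, ← ENNReal.rpow_natCast, ← ENNReal.rpow_mul]
        norm_num

theorem image_sq_Ioi : (fun r : ℝ => r ^ 2) '' Set.Ioi 0 = Set.Ioi 0 := by
  ext s
  simp only [Set.mem_image, Set.mem_Ioi]
  constructor
  · rintro ⟨r, hr, rfl⟩; positivity
  · intro hs
    exact ⟨√s, Real.sqrt_pos.2 hs, Real.sq_sqrt hs.le⟩

theorem injOn_sq_Ioi : Set.InjOn (fun r : ℝ => r ^ 2) (Set.Ioi 0) := fun _ ha _ hb h =>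
  (sq_eq_sq₀ (Set.mem_Ioi.1 ha).le (Set.mem_Ioi.1 hb).le).1 h

/-- The integral of `f ⊗ g` over the angular variable on the circle of radius `r`. -/
def angular (f g : ℝ → ℂ) (r : ℝ) : ℂ :=
  ∫ θ in Set.Ioo (-π) π, f (r * Real.cos θ) * g (r * Real.sin θ)

/-- The density of `f ⊗ g` with respect to the squared radius. -/
def radialDensity (f g : ℝ → ℂ) : ℝ → ℂ :=
  (Set.Ioi (0 : ℝ)).indicator fun s => 2⁻¹ * angular f g (√s)

theorem oscillatory_mul_eq_fourier {f g : ℝ → ℂ} (hf : Continuous f) (hg : Continuous g)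
    (hfi : Integrable f) (hgi : Integrable g) (t : ℝ) :
    (∫ w, cexp ((-(2 * t * w ^ 2) : ℝ) * I) * f w) *
      (∫ w, cexp ((-(2 * t * w ^ 2) : ℝ) * I) * g w) = 𝓕 (radialDensity f g) (π⁻¹ * t) := by
  have hpi := Real.pi_pos
  set K : ℝ × ℝ → ℂ := fun p => (cexp ((-(2 * t * p.1 ^ 2) : ℝ) * I) * f p.1) *
    (cexp ((-(2 * t * p.2 ^ 2) : ℝ) * I) * g p.2) with hK
  have hKpol (p : ℝ × ℝ) : p.1 • K (polarCoord.symm p) = cexp ((-(2 * t * p.1 ^ 2) : ℝ) * I) *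
      (p.1 * (f (p.1 * Real.cos p.2) * g (p.1 * Real.sin p.2))) := by
    have : cexp ((-(2 * t * p.1 ^ 2) : ℝ) * I) =
      cexp ((-(2 * t * (p.1 * Real.cos p.2) ^ 2) : ℝ) * I) *
      cexp ((-(2 * t * (p.1 * Real.sin p.2) ^ 2) : ℝ) * I) := by
      rw [← Complex.exp_add, ← add_mul, ← Complex.ofReal_add]
      congr 3
      linear_combination (2 * t * p.1 ^ 2) * Real.sin_sq_add_cos_sq p.2
    rw [this, hK, polarCoord_symm_apply, real_smul]
    ring
  have hint : IntegrableOn (fun p : ℝ × ℝ => p.1 • K (polarCoord.symm p)) polarCoord.target := by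
    refine ⟨?_, ?_⟩
    · simp_rw [hKpol]
      exact Continuous.aestronglyMeasurable (by fun_prop)
    · have h1 : Integrable K := by
        have e (u : ℝ → ℂ) (hu : Integrable u) :
            Integrable fun w => cexp ((-(2 * t * w ^ 2) : ℝ) * I) * u w :=
          hu.bdd_mul (c := 1) (Continuous.aestronglyMeasurable (by fun_prop))
            (.of_forall fun w => (Complex.norm_exp_ofReal_mul_I _).le)
        exact (e f hfi).mul_prod (e g hgi)
      have h2 := h1.2
      rw [HasFiniteIntegral, ← lintegral_comp_polarCoord_symm] at h2
      refine lt_of_le_of_lt (le_of_eq ?_) h2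
      refine setLIntegral_congr_fun polarCoord.open_target.measurableSet fun p hp => ?_
      rw [enorm_smul, smul_eq_mul, Real.enorm_of_nonneg (le_of_lt hp.1)]
  rw [← integral_prod_mul, ← Measure.volume_eq_prod]
  change ∫ p, K p = _
  rw [← integral_comp_polarCoord_symm]
  simp_rw [hKpol] at hint ⊢
  have htarget : polarCoord.target = Set.Ioi (0 : ℝ) ×ˢ Set.Ioo (-π) π := rfl
  rw [htarget] at hint ⊢
  rw [Measure.volume_eq_prod] at hint ⊢
  rw [setIntegral_prod _ hint, Real.fourier_real_eq_integral_exp_smul]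
  have e1 (r : ℝ) : ∫ θ in Set.Ioo (-π) π, cexp ((-(2 * t * r ^ 2) : ℝ) * I) *
      (r * (f (r * Real.cos θ) * g (r * Real.sin θ))) =
      cexp ((-(2 * t * r ^ 2) : ℝ) * I) * (r * angular f g r) := by
    rw [integral_const_mul, integral_const_mul, angular]
  simp_rw [e1]
  have e2 : ∀ v : ℝ, cexp ((-2 * π * v * (π⁻¹ * t) : ℝ) * I) • radialDensity f g v =
      (Set.Ioi (0 : ℝ)).indicator
        (fun s => cexp ((-(2 * t * s) : ℝ) * I) * (2⁻¹ * angular f g (√s))) v := by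
    intro v
    by_cases hv : v ∈ Set.Ioi (0 : ℝ)
    · simp only [radialDensity, Set.indicator_of_mem hv, smul_eq_mul]
      congr 4
      field_simp
    · simp only [radialDensity, Set.indicator_of_notMem hv, smul_zero]
  rw [integral_congr_ae (.of_forall e2), integral_indicator measurableSet_Ioi]
  conv_rhs => rw [← image_sq_Ioi]
  rw [integral_image_eq_integral_abs_deriv_smul (f' := fun r => 2 * r) measurableSet_Ioi
    (fun x _ => by simpa using (hasDerivAt_pow 2 x).hasDerivWithinAt) injOn_sq_Ioi]
  refine setIntegral_congr_fun measurableSet_Ioi fun r hr => ?_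
  have hr : 0 < r := hr
  simp only [real_smul, abs_of_pos (mul_pos two_pos hr), Real.sqrt_sq hr.le]
  push_cast
  ring

/-- A bilinear `L²` estimate in time for quadratic oscillatory integrals: in polar coordinates the
product is the Fourier transform of the radial density of `f ⊗ g`. -/
theorem lintegral_oscillatory_mul_sq_le {f g : ℝ → ℂ} (hf : Continuous f) (hg : Continuous g)
    (hfi : Integrable f) (hgi : Integrable g) :
    ∫⁻ t : ℝ, ‖∫ w, cexp ((-(2 * t * w ^ 2) : ℝ) * I) * f w‖ₑ ^ 2 *
      ‖∫ w, cexp ((-(2 * t * w ^ 2) : ℝ) * I) * g w‖ₑ ^ 2 ≤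
    ENNReal.ofReal (π ^ 2) * ((∫⁻ w, ‖f w‖ₑ ^ 2) * ∫⁻ w, ‖g w‖ₑ ^ 2) := by
  have hpi := Real.pi_pos
  simp_rw [← mul_pow, ← enorm_mul, oscillatory_mul_eq_fourier hf hg hfi hgi]
  rw [lintegral_comp_mul_left_real (a := π⁻¹) (by simp [hpi.ne'])
    (fun x => ‖𝓕 (radialDensity f g) x‖ₑ ^ 2), inv_inv, abs_of_pos hpi]
  have key (r : ℝ) (hr : 0 < r) : ENNReal.ofReal |2 * r| * ‖2⁻¹ * angular f g r‖ₑ ^ 2 ≤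
      ENNReal.ofReal π * ∫⁻ θ in Set.Ioo (-π) π, ENNReal.ofReal r *
        (‖f (r * Real.cos θ)‖ₑ ^ 2 * ‖g (r * Real.sin θ)‖ₑ ^ 2) := by
    have h1 : ‖angular f g r‖ₑ ^ 2 ≤ ENNReal.ofReal (2 * π) *
        ∫⁻ θ in Set.Ioo (-π) π, (‖f (r * Real.cos θ)‖ₑ ^ 2 * ‖g (r * Real.sin θ)‖ₑ ^ 2) := by
      refine (enorm_integral_sq_le _ (Continuous.aestronglyMeasurable (by fun_prop))).trans ?_
      simp only [enorm_mul, mul_pow, Measure.restrict_apply_univ, Real.volume_Ioo, sub_neg_eq_add,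
        ← two_mul, le_refl]
    have h2 : ‖(2⁻¹ : ℂ)‖ₑ = ENNReal.ofReal 2⁻¹ := by
      rw [← ofReal_norm]; simp
    rw [enorm_mul, mul_pow, h2, lintegral_const_mul' _ _ (by finiteness),
      abs_of_pos (by positivity)]
    calc _ ≤ ENNReal.ofReal (2 * r) * (ENNReal.ofReal 2⁻¹ ^ 2 * (ENNReal.ofReal (2 * π) *
        ∫⁻ θ in Set.Ioo (-π) π, (‖f (r * Real.cos θ)‖ₑ ^ 2 * ‖g (r * Real.sin θ)‖ₑ ^ 2))) := by
          gcongr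
      _ = _ := by
          rw [← mul_assoc, ← mul_assoc, ← mul_assoc, ← ENNReal.ofReal_pow (by positivity),
            ← ENNReal.ofReal_mul (by positivity), ← ENNReal.ofReal_mul (by positivity),
            ← ENNReal.ofReal_mul (by positivity)]
          congr 2
          ring
  have hbound : ∫⁻ x, ‖radialDensity f g x‖ₑ ^ 2 ≤
      ENNReal.ofReal π * ((∫⁻ w, ‖f w‖ₑ ^ 2) * ∫⁻ w, ‖g w‖ₑ ^ 2) := by
    have e1 : ∀ x, ‖radialDensity f g x‖ₑ ^ 2 =
        (Set.Ioi (0 : ℝ)).indicator (fun s => ‖2⁻¹ * angular f g (√s)‖ₑ ^ 2) x := by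
      intro x
      by_cases hx : x ∈ Set.Ioi (0 : ℝ) <;> simp [radialDensity, hx]
    simp_rw [e1]
    rw [lintegral_indicator measurableSet_Ioi]
    conv_lhs => rw [← image_sq_Ioi]
    rw [lintegral_image_eq_lintegral_abs_deriv_mul (f' := fun r => 2 * r) measurableSet_Ioi
      (fun x _ => by simpa using (hasDerivAt_pow 2 x).hasDerivWithinAt) injOn_sq_Ioi]
    calc _ ≤ ∫⁻ r in Set.Ioi 0, ENNReal.ofReal π * ∫⁻ θ in Set.Ioo (-π) π, ENNReal.ofReal r *
        (‖f (r * Real.cos θ)‖ₑ ^ 2 * ‖g (r * Real.sin θ)‖ₑ ^ 2) := by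
          refine setLIntegral_mono' measurableSet_Ioi fun r hr => ?_
          rw [Real.sqrt_sq (le_of_lt hr)]
          exact key r hr
      _ = ENNReal.ofReal π * ∫⁻ p in polarCoord.target, ENNReal.ofReal p.1 •
          (fun q : ℝ × ℝ => ‖f q.1‖ₑ ^ 2 * ‖g q.2‖ₑ ^ 2) (polarCoord.symm p) := by
          rw [lintegral_const_mul' _ _ (by finiteness)]
          congr 1
          have htarget : polarCoord.target = Set.Ioi (0 : ℝ) ×ˢ Set.Ioo (-π) π := rfl
          rw [htarget, Measure.volume_eq_prod, setLIntegral_prod]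
          · rfl
          · simp only [polarCoord_symm_apply]
            exact Measurable.aemeasurable (by fun_prop)
      _ = _ := by
          rw [lintegral_comp_polarCoord_symm
              (fun q : ℝ × ℝ => ‖f q.1‖ₑ ^ 2 * ‖g q.2‖ₑ ^ 2),
            Measure.volume_eq_prod, lintegral_prod_mul
              (f := fun w => ‖f w‖ₑ ^ 2) (g := fun w => ‖g w‖ₑ ^ 2)
              (by fun_prop) (by fun_prop)]
  calc _ ≤ ENNReal.ofReal π * (ENNReal.ofReal π * ((∫⁻ w, ‖f w‖ₑ ^ 2) * ∫⁻ w, ‖g w‖ₑ ^ 2)) := by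
        gcongr
        exact (lintegral_fourier_sq_le _).trans hbound
    _ = _ := by rw [← mul_assoc, ← ENNReal.ofReal_mul hpi.le, sq]

theorem integrable_oscillatory_mul {α : Type*} [TopologicalSpace α] [MeasurableSpace α]
    [OpensMeasurableSpace α] {μ : Measure α} {u : α → ℂ} (hu : Integrable u μ) {ψ : α → ℝ}
    (hψ : Continuous ψ) : Integrable (fun x => cexp (ψ x * I) * u x) μ :=
  hu.bdd_mul (c := 1) (Continuous.aestronglyMeasurable (by fun_prop))
    (.of_forall fun w => (Complex.norm_exp_ofReal_mul_I _).le)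

theorem FT1_IFT1_enorm_le {g : ℝ → ℂ} (hg : Integrable g) (hc : Continuous g) (ξ : ℝ) :
    ‖FT1 (IFT1 g) ξ‖ₑ ≤ ‖g ξ‖ₑ := by
  have hpi := Real.pi_pos
  by_cases hi : Integrable (IFT1 g)
  · have hF : Integrable (𝓕 g) := by
      have h1 := (hi.comp_mul_left' (R := -(2 * π)) (by simp [hpi.ne'])).const_mul (2 * (π : ℂ))
      refine h1.congr (.of_forall fun x => ?_)
      simp only [IFT1_eq_fourier]
      rw [← mul_assoc, mul_inv_cancel₀ (by simp [hpi.ne']), one_mul]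
      field_simp
    refine le_of_eq (congrArg _ ?_)
    conv_rhs => rw [← hc.fourierInv_fourier_eq hg hF]
    have h2 : ∀ x : ℝ, cexp (-I * ξ * x) * IFT1 g x =
        (2 * (π : ℂ))⁻¹ * (fun v : ℝ => cexp ((2 * π * (v * ξ) : ℝ) * I) * 𝓕 g v)
          (-(2 * π)⁻¹ * x) := by
      intro x
      rw [IFT1_eq_fourier]
      have : (-I * ξ * x : ℂ) = ((2 * π * (-(2 * π)⁻¹ * x * ξ) : ℝ) : ℂ) * I := by
        push_cast
        field_simp
      rw [this]
      ring
    rw [FT1, integral_congr_ae (.of_forall h2), integral_const_mul,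
      Measure.integral_comp_mul_left (fun v : ℝ => cexp ((2 * π * (v * ξ) : ℝ) * I) * 𝓕 g v),
      Real.fourierInv_eq']
    rw [inv_neg, abs_neg, inv_inv, abs_of_pos (by positivity), real_smul, ← mul_assoc]
    push_cast
    rw [inv_mul_cancel₀ (by simp [hpi.ne']), one_mul]
    refine integral_congr_ae (.of_forall fun v => ?_)
    simp [mul_comm]
  · have : FT1 (IFT1 g) ξ = 0 := by
      refine integral_undef fun h => hi ?_
      have h1 := integrable_oscillatory_mul h (ψ := fun x => ξ * x) (by fun_prop)
      refine h1.congr (.of_forall fun x => ?_)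
      simp only
      rw [← mul_assoc, ← Complex.exp_add]
      have : ((ξ * x : ℝ) : ℂ) * I + -I * ξ * x = 0 := by push_cast; ring
      rw [this, Complex.exp_zero, one_mul]
    simp [this]

theorem exists_schwartz_FT2 (Λ₀ : 𝓢(ℝ × ℝ, ℂ)) :
    ∃ S : 𝓢(ℝ × ℝ, ℂ), ∀ ξ η, FT2 (fun a b => Λ₀ (a, b)) ξ η = S (ξ, η) := by
  have hpi := Real.pi_pos
  let e := WithLp.prodContinuousLinearEquiv 2 ℝ ℝ ℝ
  let f : 𝓢(WithLp 2 (ℝ × ℝ), ℂ) := compCLMOfContinuousLinearEquiv ℂ e Λ₀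
  let d : (ℝ × ℝ) ≃L[ℝ] (ℝ × ℝ) :=
    ContinuousLinearEquiv.smulLeft (Units.mk0 ((2 * π)⁻¹ : ℝ) (by positivity))
  refine ⟨compCLMOfContinuousLinearEquiv ℂ (d.trans e.symm) (𝓕 f), fun ξ η => ?_⟩
  have h1 : compCLMOfContinuousLinearEquiv ℂ (d.trans e.symm) (𝓕 f) (ξ, η) =
      𝓕 (f : WithLp 2 (ℝ × ℝ) → ℂ) (WithLp.toLp 2 ((2 * π)⁻¹ * ξ, (2 * π)⁻¹ * η)) := by
    rw [← SchwartzMap.fourier_coe]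
    rfl
  rw [h1, Real.fourier_eq', ← (WithLp.volume_preserving_toLp ℝ ℝ).integral_comp
    (MeasurableEquiv.toLp 2 (ℝ × ℝ)).measurableEmbedding, Measure.volume_eq_prod, integral_prod]
  · rw [FT2]
    congr 1 with x
    congr 1 with y
    simp only [WithLp.prod_inner_apply, smul_eq_mul]
    congr 2
    simp
    field_simp
  · have h2 : Integrable (fun p : ℝ × ℝ => Λ₀ p) (volume.prod volume) := Λ₀.integrable
    exact integrable_oscillatory_mul h2 (ψ := fun p => -2 * π * inner ℝ (WithLp.toLp 2 p)
      (WithLp.toLp 2 ((2 * π)⁻¹ * ξ, (2 * π)⁻¹ * η))) (by fun_prop)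

/-- The linear change of variables `(ζ, w) ↦ (ζ / 2 + w, ζ / 2 - w)`. -/
def centerOfMass : (ℝ × ℝ) ≃L[ℝ] (ℝ × ℝ) :=
  LinearEquiv.toContinuousLinearEquiv
    { toFun := fun p => (p.1 / 2 + p.2, p.1 / 2 - p.2)
      invFun := fun p => (p.1 + p.2, (p.1 - p.2) / 2)
      map_add' := fun p q => by ext <;> simp <;> ring
      map_smul' := fun c p => by ext <;> simp <;> ring
      left_inv := fun p => by ext <;> simp
      right_inv := fun p => by ext <;> simp <;> ring }

/-- The linear change of variables `(ξ, ζ) ↦ (ξ, ζ - ξ)`. -/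
def shear : (ℝ × ℝ) ≃L[ℝ] (ℝ × ℝ) :=
  LinearEquiv.toContinuousLinearEquiv
    { toFun := fun p => (p.1, p.2 - p.1)
      invFun := fun p => (p.1, p.2 + p.1)
      map_add' := fun p q => by ext <;> simp ; ring
      map_smul' := fun c p => by ext <;> simp ; ring
      left_inv := fun p => by ext <;> simp
      right_inv := fun p => by ext <;> simp }

theorem integral_integral_centerOfMass {φ : ℝ → ℝ → ℂ}
    (hφ : Integrable (fun p : ℝ × ℝ => φ p.1 (p.2 - p.1)) (volume.prod volume)) :
    ∫ ξ, ∫ η, φ ξ η = ∫ ζ, ∫ w, φ (ζ / 2 + w) (ζ / 2 - w) := by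
  calc _ = ∫ ξ, ∫ ζ, φ ξ (ζ - ξ) := by
        congr 1 with ξ
        exact (integral_sub_right_eq_self (φ ξ) ξ).symm
    _ = ∫ ζ, ∫ ξ, φ ξ (ζ - ξ) := integral_integral_swap hφ
    _ = _ := by
        congr 1 with ζ
        rw [← integral_add_left_eq_self (fun ξ => φ ξ (ζ - ξ)) (ζ / 2)]
        congr 1 with w
        congr 1
        ring

theorem lintegral_lintegral_centerOfMass {φ : ℝ → ℝ → ℝ≥0∞}
    (hφ : Measurable (fun p : ℝ × ℝ => φ p.1 (p.2 - p.1))) :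
    ∫⁻ ξ, ∫⁻ η, φ ξ η = ∫⁻ ζ, ∫⁻ w, φ (ζ / 2 + w) (ζ / 2 - w) := by
  calc _ = ∫⁻ ξ, ∫⁻ ζ, φ ξ (ζ - ξ) := by
        congr 1 with ξ
        exact (lintegral_sub_right_eq_self (φ ξ) ξ).symm
    _ = ∫⁻ ζ, ∫⁻ ξ, φ ξ (ζ - ξ) := lintegral_lintegral_swap hφ.aemeasurable
    _ = _ := by
        congr 1 with ζ
        rw [← lintegral_add_left_eq_self (fun ξ => φ ξ (ζ - ξ)) (ζ / 2)]
        congr 1 with w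
        congr 1
        ring

theorem exists_decay_snd (S : 𝓢(ℝ × ℝ, ℂ)) :
    ∃ C : ℝ, ∀ ζ w, ‖S (ζ, w)‖ ≤ C * (1 + w ^ 2)⁻¹ := by
  obtain ⟨C₀, _, h0⟩ := S.decay 0 0
  obtain ⟨C₂, _, h2⟩ := S.decay 2 0
  refine ⟨C₀ + C₂, fun ζ w => ?_⟩
  have h0 := h0 (ζ, w)
  have h2 := h2 (ζ, w)
  simp only [pow_zero, one_mul, norm_iteratedFDeriv_zero] at h0 h2
  have hw : w ^ 2 ≤ ‖(ζ, w)‖ ^ 2 := by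
    rw [← sq_abs, ← Real.norm_eq_abs]
    gcongr
    exact norm_snd_le (ζ, w)
  rw [← div_eq_mul_inv, le_div_iff₀ (by positivity)]
  nlinarith [mul_le_mul_of_nonneg_right hw (norm_nonneg (S (ζ, w)))]

theorem integrable_section (S : 𝓢(ℝ × ℝ, ℂ)) (ζ : ℝ) : Integrable fun w => S (ζ, w) := by
  obtain ⟨C, hC⟩ := exists_decay_snd S
  exact (integrable_inv_one_add_sq.const_mul C).mono'
    (S.continuous.comp (by fun_prop)).aestronglyMeasurable (.of_forall fun w => hC ζ w)

/-- The value at the origin of the one-dimensional Schrödinger flow with frequency data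
`S (ζ, ·)`. -/
def oscSection (S : 𝓢(ℝ × ℝ, ℂ)) (t ζ : ℝ) : ℂ :=
  ∫ w, cexp ((-(2 * t * w ^ 2) : ℝ) * I) * S (ζ, w)

theorem continuous_oscSection (S : 𝓢(ℝ × ℝ, ℂ)) :
    Continuous fun p : ℝ × ℝ => oscSection S p.1 p.2 := by
  obtain ⟨C, hC⟩ := exists_decay_snd S
  have hS := S.continuous
  refine continuous_of_dominated (bound := fun w => C * (1 + w ^ 2)⁻¹)
    (fun p => Continuous.aestronglyMeasurable (by fun_prop)) (fun p => .of_forall fun w => ?_)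
    (integrable_inv_one_add_sq.const_mul C) (.of_forall fun w => by fun_prop)
  rw [norm_mul, Complex.norm_exp_ofReal_mul_I, one_mul]
  exact hC _ _

theorem integrable_oscSection (S : 𝓢(ℝ × ℝ, ℂ)) (t : ℝ) : Integrable (oscSection S t) := by
  have h : Integrable (fun p : ℝ × ℝ => S p) (volume.prod volume) := S.integrable
  exact (integrable_oscillatory_mul h (ψ := fun p => -(2 * t * p.2 ^ 2))
    (by fun_prop)).integral_prod_left

/-- The spatial Fourier transform of the diagonal trace of the flow. -/
def diagFourier (S : 𝓢(ℝ × ℝ, ℂ)) (t ζ : ℝ) : ℂ :=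
  (2 * (π : ℂ))⁻¹ * (cexp ((-(t * ζ ^ 2 / 2) : ℝ) * I) *
    oscSection (compCLMOfContinuousLinearEquiv ℂ centerOfMass S) t ζ)

theorem freeLambda_diag {Λ₀ S : 𝓢(ℝ × ℝ, ℂ)}
    (hS : ∀ ξ η, FT2 (fun a b => Λ₀ (a, b)) ξ η = S (ξ, η)) (t a : ℝ) :
    freeLambda (fun a b => Λ₀ (a, b)) t a a = IFT1 (diagFourier S t) a := by
  rw [freeLambda, IFT2, IFT1]
  simp_rw [hS]
  rw [integral_integral_centerOfMass]
  · rw [sq, mul_inv, mul_assoc]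
    congr 1
    rw [← integral_const_mul]
    congr 1 with ζ
    rw [diagFourier, oscSection, ← integral_const_mul, ← integral_const_mul, ← integral_const_mul,
      ← integral_const_mul]
    congr 1 with w
    change _ * (_ * (_ * S (ζ / 2 + w, ζ / 2 - w))) =
      _ * (_ * (_ * (_ * S (ζ / 2 + w, ζ / 2 - w))))
    have e : cexp (I * ((ζ / 2 + w : ℝ) * a + (ζ / 2 - w : ℝ) * a)) *
        cexp (-I * t * ((ζ / 2 + w : ℝ) ^ 2 + (ζ / 2 - w : ℝ) ^ 2)) =
        cexp (I * ζ * a) * (cexp ((-(t * ζ ^ 2 / 2) : ℝ) * I) *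
          cexp ((-(2 * t * w ^ 2) : ℝ) * I)) := by
      simp_rw [← Complex.exp_add]
      congr 1
      push_cast
      ring
    linear_combination (2 * (π : ℂ))⁻¹ * S (ζ / 2 + w, ζ / 2 - w) * e
  · have h : Integrable (compCLMOfContinuousLinearEquiv ℂ shear S) (volume.prod volume) :=
      SchwartzMap.integrable _
    have h1 := integrable_oscillatory_mul (integrable_oscillatory_mul h
      (ψ := fun p => -(t * (p.1 ^ 2 + (p.2 - p.1) ^ 2))) (by fun_prop))
      (ψ := fun p => p.1 * a + (p.2 - p.1) * a) (by fun_prop)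
    refine h1.congr (.of_forall fun p => ?_)
    change cexp _ * (cexp _ * S (p.1, p.2 - p.1)) = cexp _ * (cexp _ * S (p.1, p.2 - p.1))
    congr 2
    · push_cast
      ring
    · congr 1
      push_cast
      ring

theorem enorm_diagFourier (S : 𝓢(ℝ × ℝ, ℂ)) (t ζ : ℝ) :
    ‖diagFourier S t ζ‖ₑ = ENNReal.ofReal (2 * π)⁻¹ *
      ‖oscSection (compCLMOfContinuousLinearEquiv ℂ centerOfMass S) t ζ‖ₑ := by
  have h1 : ‖(2 * (π : ℂ))⁻¹‖ₑ = ENNReal.ofReal (2 * π)⁻¹ := by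
    rw [← ofReal_norm]
    congr 1
    simp [abs_of_pos Real.pi_pos]
  rw [diagFourier, enorm_mul, enorm_mul, h1, ← ofReal_norm (cexp _),
    Complex.norm_exp_ofReal_mul_I, ENNReal.ofReal_one, one_mul]

theorem enorm_FT1_freeLambda_diag_le {Λ₀ S : 𝓢(ℝ × ℝ, ℂ)}
    (hS : ∀ ξ η, FT2 (fun a b => Λ₀ (a, b)) ξ η = S (ξ, η)) (t ζ : ℝ) :
    ‖FT1 (fun a => freeLambda (fun a b => Λ₀ (a, b)) t a a) ζ‖ₑ ≤ ENNReal.ofReal (2 * π)⁻¹ *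
      ‖oscSection (compCLMOfContinuousLinearEquiv ℂ centerOfMass S) t ζ‖ₑ := by
  simp_rw [freeLambda_diag hS, ← enorm_diagFourier]
  refine FT1_IFT1_enorm_le ?_ ?_ ζ
  · exact (integrable_oscillatory_mul (integrable_oscSection _ t) (by fun_prop)).const_mul _
  · have := (continuous_oscSection (compCLMOfContinuousLinearEquiv ℂ centerOfMass S)).comp
      (Continuous.prodMk_right t)
    simp only [Function.comp_def] at this
    unfold diagFourier
    fun_prop

theorem IFT2_eq_IFT1_IFT1 (k : ℝ → ℝ → ℂ) (x y : ℝ) :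
    IFT2 k x y = IFT1 (fun ξ => IFT1 (k ξ) y) x := by
  simp only [IFT2, IFT1, mul_left_comm (cexp _) (2 * (π : ℂ))⁻¹, integral_const_mul]
  simp_rw [← integral_const_mul (cexp _), ← mul_assoc, ← Complex.exp_add, sq, mul_inv, mul_add,
    mul_assoc]

theorem lintegral_sq_le_L2K_IFT2 {k : ℝ → ℝ → ℂ} (hc : Continuous fun p : ℝ × ℝ => k p.1 p.2)
    (hk : Integrable (fun p : ℝ × ℝ => k p.1 p.2) (volume.prod volume)) :
    ENNReal.ofReal (2 * π)⁻¹ ^ 2 * ∫⁻ ξ, ∫⁻ η, ‖k ξ η‖ₑ ^ 2 ≤ L2K (IFT2 k) ^ 2 := by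
  have hm1 : StronglyMeasurable fun p : ℝ × ℝ => IFT1 (k p.1) p.2 := by
    refine StronglyMeasurable.const_mul ?_ _
    exact StronglyMeasurable.integral_prod_right (f := fun (p : ℝ × ℝ) (η : ℝ) =>
      cexp (I * (η : ℂ) * (p.2 : ℂ)) * k p.1 η) (Continuous.stronglyMeasurable (by
        have : Continuous fun q : (ℝ × ℝ) × ℝ => k q.1.1 q.2 :=
          hc.comp (by fun_prop : Continuous fun q : (ℝ × ℝ) × ℝ => (q.1.1, q.2))
        simp only [Function.uncurry_def]
        fun_prop))
  have hm2 : StronglyMeasurable fun p : ℝ × ℝ => IFT2 k p.1 p.2 := by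
    simp_rw [IFT2_eq_IFT1_IFT1]
    refine StronglyMeasurable.const_mul ?_ _
    refine StronglyMeasurable.integral_prod_right (f := fun (p : ℝ × ℝ) (ξ : ℝ) =>
      cexp (I * (ξ : ℂ) * (p.1 : ℂ)) * IFT1 (k ξ) p.2) ?_
    refine StronglyMeasurable.mul (Continuous.stronglyMeasurable (by fun_prop)) ?_
    exact hm1.comp_measurable (g := fun q : (ℝ × ℝ) × ℝ => (q.2, q.1.2)) (by fun_prop)
  rw [L2K, eLpNorm_two_sq, Measure.volume_eq_prod,
    lintegral_prod_symm' _ (hm2.measurable.enorm.pow_const 2)]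
  calc _ ≤ ENNReal.ofReal (2 * π)⁻¹ * ∫⁻ ξ, ∫⁻ y, ‖IFT1 (k ξ) y‖ₑ ^ 2 := by
        rw [sq, mul_assoc]
        refine mul_le_mul_right ?_ _
        rw [← lintegral_const_mul' _ _ (by finiteness)]
        refine lintegral_mono_ae ?_
        filter_upwards [hk.prod_right_ae] with ξ hξ
        exact le_lintegral_IFT1_sq hξ
    _ = ∫⁻ y, ENNReal.ofReal (2 * π)⁻¹ * ∫⁻ ξ, ‖IFT1 (k ξ) y‖ₑ ^ 2 := by
        rw [lintegral_lintegral_swap, lintegral_const_mul' _ _ (by finiteness)]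
        exact (hm1.measurable.enorm.pow_const 2).aemeasurable
    _ ≤ _ := by
        refine lintegral_mono fun y => ?_
        simp_rw [IFT2_eq_IFT1_IFT1]
        refine le_lintegral_IFT1_sq (Integrable.const_mul ?_ _)
        have h := (integrable_oscillatory_mul hk (ψ := fun p => p.2 * y)
          (by fun_prop)).integral_prod_left
        refine h.congr (.of_forall fun ξ => ?_)
        refine integral_congr_ae (.of_forall fun η => ?_)
        simp only
        congr 2
        push_cast
        ring

theorem integrable_multiplier_mul {ε : ℝ} (hε0 : 0 < ε) (hε1 : ε < 1) (S : 𝓢(ℝ × ℝ, ℂ)) :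
    Integrable (fun p : ℝ × ℝ => (((|p.1 + p.2| / 2) ^ ε : ℝ) : ℂ) * S (p.1, p.2))
      (volume.prod volume) := by
  have h0 : Integrable (fun p : ℝ × ℝ => S p) (volume.prod volume) := S.integrable
  have h1 := S.integrable_pow_mul (volume.prod volume) 1
  refine (h0.norm.add h1).mono' ?_ (.of_forall fun p => ?_)
  · have hS := S.continuous
    refine Continuous.aestronglyMeasurable (.mul (continuous_ofReal.comp ?_) hS)
    exact .rpow_const (by fun_prop) fun p => .inr hε0.le
  · have h2 : |p.1 + p.2| / 2 ≤ ‖p‖ := by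
      have := norm_fst_le p
      have := norm_snd_le p
      simp only [Real.norm_eq_abs] at *
      linarith [abs_add_le p.1 p.2]
    have h3 : (|p.1 + p.2| / 2) ^ ε ≤ 1 + ‖p‖ :=
      calc _ ≤ (1 + ‖p‖) ^ ε := by gcongr; linarith
        _ ≤ (1 + ‖p‖) ^ (1 : ℝ) := by gcongr; linarith [norm_nonneg p]
        _ = _ := Real.rpow_one _
    rw [norm_mul, Complex.norm_real, Real.norm_of_nonneg (by positivity)]
    calc _ ≤ (1 + ‖p‖) * ‖S p‖ := by gcongr
      _ = _ := by simp only [Pi.add_apply, pow_one]; ring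

theorem lintegral_multiplier_sq {ε : ℝ} (hε0 : 0 < ε) (S : 𝓢(ℝ × ℝ, ℂ)) :
    ∫⁻ ζ, ‖((|ζ| ^ ε : ℝ) : ℂ)‖ₑ ^ 2 *
      ∫⁻ w, ‖compCLMOfContinuousLinearEquiv ℂ centerOfMass S (ζ, w)‖ₑ ^ 2 =
    ENNReal.ofReal (2 ^ ε) ^ 2 *
      ∫⁻ ξ, ∫⁻ η, ‖(((|ξ + η| / 2) ^ ε : ℝ) : ℂ) * S (ξ, η)‖ₑ ^ 2 := by
  have hS := S.continuous
  have hm : Continuous fun r : ℝ => (|r| / 2) ^ ε :=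
    .rpow_const (by fun_prop) fun p => .inr hε0.le
  rw [lintegral_lintegral_centerOfMass (Continuous.measurable (by
    have := hm.comp (by fun_prop : Continuous fun p : ℝ × ℝ => p.1 + (p.2 - p.1))
    simp only [Function.comp_def] at this
    fun_prop)), ← lintegral_const_mul' _ _ (by finiteness)]
  congr 1 with ζ
  have h1 (w : ℝ) : ‖(((|ζ / 2 + w + (ζ / 2 - w)| / 2) ^ ε : ℝ) : ℂ) *
      S (ζ / 2 + w, ζ / 2 - w)‖ₑ ^ 2 = ‖(((|ζ| / 2) ^ ε : ℝ) : ℂ)‖ₑ ^ 2 *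
        ‖compCLMOfContinuousLinearEquiv ℂ centerOfMass S (ζ, w)‖ₑ ^ 2 := by
    rw [show ζ / 2 + w + (ζ / 2 - w) = ζ by ring, enorm_mul, mul_pow]
    rfl
  simp_rw [h1]
  rw [lintegral_const_mul' _ _ (by finiteness), ← mul_assoc, ← mul_pow]
  congr 2
  rw [← ofReal_norm, ← ofReal_norm, Complex.norm_real, Complex.norm_real,
    ← ENNReal.ofReal_mul (by positivity), Real.norm_of_nonneg (by positivity),
    Real.norm_of_nonneg (by positivity), ← Real.mul_rpow (by positivity) (by positivity)]
  congr 2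
  ring

theorem lintegral_sq_lintegral_oscSection_le (S : 𝓢(ℝ × ℝ, ℂ)) {c : ℝ → ℝ≥0∞} (hc : Measurable c)
    (hfin : ∀ ζ, c ζ ≠ ⊤) :
    ∫⁻ t, (∫⁻ ζ, c ζ * ‖oscSection S t ζ‖ₑ ^ 2) ^ 2 ≤
      ENNReal.ofReal (π ^ 2) * (∫⁻ ζ, c ζ * ∫⁻ w, ‖S (ζ, w)‖ₑ ^ 2) ^ 2 := by
  have hO := (continuous_oscSection S).measurable
  have hS := S.continuous
  have hO1 (t : ℝ) : Measurable fun ζ => c ζ * ‖oscSection S t ζ‖ₑ ^ 2 :=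
    hc.mul ((hO.comp (by fun_prop : Measurable fun ζ : ℝ => (t, ζ))).enorm.pow_const 2)
  have hO2 : Measurable fun p : ℝ × ℝ × ℝ => (c p.2.1 * ‖oscSection S p.1 p.2.1‖ₑ ^ 2) *
      (c p.2.2 * ‖oscSection S p.1 p.2.2‖ₑ ^ 2) :=
    ((hc.comp (by fun_prop)).mul
      ((hO.comp (by fun_prop : Measurable fun p : ℝ × ℝ × ℝ => (p.1, p.2.1))).enorm.pow_const
        2)).mul
    ((hc.comp (by fun_prop)).mul
      ((hO.comp (by fun_prop : Measurable fun p : ℝ × ℝ × ℝ => (p.1, p.2.2))).enorm.pow_const 2))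
  have hN : Measurable fun ζ => c ζ * ∫⁻ w, ‖S (ζ, w)‖ₑ ^ 2 :=
    hc.mul (Measurable.lintegral_prod_right' (f := fun p : ℝ × ℝ => ‖S p‖ₑ ^ 2) (by fun_prop))
  calc _ = ∫⁻ t, ∫⁻ q : ℝ × ℝ, (c q.1 * ‖oscSection S t q.1‖ₑ ^ 2) *
        (c q.2 * ‖oscSection S t q.2‖ₑ ^ 2) := by
        congr 1 with t
        rw [sq, Measure.volume_eq_prod,
          lintegral_prod_mul (hO1 t).aemeasurable (hO1 t).aemeasurable]
    _ = ∫⁻ q : ℝ × ℝ, ∫⁻ t, (c q.1 * ‖oscSection S t q.1‖ₑ ^ 2) *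
        (c q.2 * ‖oscSection S t q.2‖ₑ ^ 2) := lintegral_lintegral_swap hO2.aemeasurable
    _ ≤ ∫⁻ q : ℝ × ℝ, ENNReal.ofReal (π ^ 2) * ((c q.1 * ∫⁻ w, ‖S (q.1, w)‖ₑ ^ 2) *
        (c q.2 * ∫⁻ w, ‖S (q.2, w)‖ₑ ^ 2)) := by
        refine lintegral_mono fun q => ?_
        simp_rw [mul_mul_mul_comm (c q.1)]
        rw [lintegral_const_mul' _ _ (ENNReal.mul_ne_top (hfin _) (hfin _)), mul_left_comm]
        refine mul_le_mul_right ?_ _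
        exact lintegral_oscillatory_mul_sq_le (by fun_prop) (by fun_prop)
          (integrable_section S q.1) (integrable_section S q.2)
    _ = _ := by
        rw [lintegral_const_mul' _ _ (by finiteness), Measure.volume_eq_prod,
          lintegral_prod_mul hN.aemeasurable hN.aemeasurable, ← sq]

theorem MixedN2_four_two_pow_le (u : ℝ → ℝ → ℂ) :
    MixedN2 volume 4 2 u ^ 4 ≤ ∫⁻ t, (∫⁻ x, ‖u t x‖ₑ ^ 2) ^ 2 := by
  rw [MixedN2, eLpNorm_eq_lintegral_rpow_enorm_toReal (by norm_num) (by norm_num),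
    ← ENNReal.rpow_natCast, ← ENNReal.rpow_mul]
  norm_num
  refine lintegral_mono fun t => ?_
  rw [← eLpNorm_two_sq, ← pow_mul]
  norm_num
  gcongr
  rw [Real.enorm_of_nonneg ENNReal.toReal_nonneg]
  exact ENNReal.ofReal_toReal_le

/-- Diagonal trace estimate with fractional derivatives for the free
two-variable Schrödinger flow. -/
theorem diagonal_trace_fractional (ε : ℝ) (hε0 : 0 < ε) (hε1 : ε < 1) :
    ∃ C : ℝ, 0 < C ∧ ∀ Λ₀ : 𝓢(ℝ × ℝ, ℂ),
      MixedN2 volume 4 2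
          (fun t x => absDx ε (fun a => freeLambda (fun a b => Λ₀ (a, b)) t a a) x)
        ≤ ENNReal.ofReal C * L2K (absDxpy ε (fun a b => Λ₀ (a, b))) := by
  have hpi := Real.pi_pos
  refine ⟨2 ^ ε, by positivity, fun Λ₀ => ?_⟩
  obtain ⟨S, hS⟩ := exists_schwartz_FT2 Λ₀
  set S' := compCLMOfContinuousLinearEquiv ℂ centerOfMass S with hS'
  set k : ℝ → ℝ → ℂ := fun ξ η => (((|ξ + η| / 2) ^ ε : ℝ) : ℂ) * S (ξ, η)
  have hkc : Continuous fun p : ℝ × ℝ => k p.1 p.2 :=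
    .mul (continuous_ofReal.comp (.rpow_const (by fun_prop) fun p => .inr hε0.le)) S.continuous
  have hL : L2K (absDxpy ε (fun a b => Λ₀ (a, b))) = L2K (IFT2 k) := by
    unfold absDxpy
    simp_rw [hS]
    rfl
  set L := L2K (IFT2 k)
  have hR := lintegral_sq_le_L2K_IFT2 hkc (integrable_multiplier_mul hε0 hε1 S)
  have hspace (t : ℝ) :
      ∫⁻ x, ‖absDx ε (fun a => freeLambda (fun a b => Λ₀ (a, b)) t a a) x‖ₑ ^ 2 ≤
        ENNReal.ofReal (2 * π)⁻¹ ^ 3 *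
          ∫⁻ ζ, ‖((|ζ| ^ ε : ℝ) : ℂ)‖ₑ ^ 2 * ‖oscSection S' t ζ‖ₑ ^ 2 := by
    refine (lintegral_IFT1_sq_le _).trans ?_
    rw [pow_succ', mul_assoc]
    refine mul_le_mul_right ?_ _
    rw [← lintegral_const_mul' _ _ (by finiteness)]
    refine lintegral_mono fun ζ => ?_
    rw [enorm_mul, mul_pow, mul_left_comm, ← mul_pow (ENNReal.ofReal _)]
    gcongr
    exact enorm_FT1_freeLambda_diag_le hS t ζ
  rw [hL, ← ENNReal.pow_le_pow_left_iff (n := 4) (by norm_num)]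
  have hmeas : Measurable fun ζ : ℝ => ‖((|ζ| ^ ε : ℝ) : ℂ)‖ₑ ^ 2 := by fun_prop
  have hunit : ENNReal.ofReal (2 * π)⁻¹ * ENNReal.ofReal π ≤ 1 := by
    rw [← ENNReal.ofReal_mul (by positivity), ← ENNReal.ofReal_one]
    gcongr
    field_simp
    norm_num
  calc _ ≤ ∫⁻ t, (ENNReal.ofReal (2 * π)⁻¹ ^ 3 *
          ∫⁻ ζ, ‖((|ζ| ^ ε : ℝ) : ℂ)‖ₑ ^ 2 * ‖oscSection S' t ζ‖ₑ ^ 2) ^ 2 := by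
        refine (MixedN2_four_two_pow_le _).trans (lintegral_mono fun t => ?_)
        exact pow_le_pow_left' (hspace t) 2
    _ ≤ (ENNReal.ofReal (2 * π)⁻¹ ^ 3) ^ 2 * (ENNReal.ofReal (π ^ 2) *
          (∫⁻ ζ, ‖((|ζ| ^ ε : ℝ) : ℂ)‖ₑ ^ 2 * ∫⁻ w, ‖S' (ζ, w)‖ₑ ^ 2) ^ 2) := by
        simp_rw [mul_pow _ _ 2]
        rw [lintegral_const_mul' _ _ (by finiteness)]
        exact mul_le_mul_right
          (lintegral_sq_lintegral_oscSection_le S' hmeas fun ζ => by finiteness) _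
    _ = (ENNReal.ofReal (2 * π)⁻¹ * ENNReal.ofReal π) ^ 2 * (ENNReal.ofReal (2 ^ ε) ^ 4 *
          (ENNReal.ofReal (2 * π)⁻¹ ^ 2 * ∫⁻ ξ, ∫⁻ η, ‖k ξ η‖ₑ ^ 2) ^ 2) := by
        rw [hS', lintegral_multiplier_sq hε0, ENNReal.ofReal_pow hpi.le]
        ring
    _ ≤ 1 ^ 2 * (ENNReal.ofReal (2 ^ ε) ^ 4 * (L ^ 2) ^ 2) :=
        mul_le_mul' (pow_le_pow_left' hunit 2) (mul_le_mul_right (pow_le_pow_left' hR 2) _)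
    _ = _ := by ring

end
end

section
/- Non-endpoint Strichartz estimate for the free two-variable Schrödinger flow: let (k,ℓ) ∈ (2,∞]×[2,∞] satisfy 2/k + 1/ℓ = 1/2. Then there is a constant C = C(k,ℓ) such that for every Schwartz Λ₀ on ℝ², ‖ e^{it(Δ_x+Δ_y)} Λ₀ ‖_{L^k(dt)L^ℓ(dx)L²(dy)} ≤ C ‖Λ₀‖_{L²(ℝ²)}. -/
open MeasureTheory Complex SchwartzMap
open scoped ENNReal NNReal Real

noncomputable section

theorem lintegral_gaussian_weight (g : ℝ → ℂ) (hg : Integrable g) (x τ : ℝ → ℝ)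
    (hx : Measurable x) (hτ : Measurable τ) {ε : ℝ} (hε : 0 < ε) :
    ∫⁻ ξ : ℝ, ‖∫ a, cexp (I * (x a * ξ + τ a * ξ ^ 2)) * g a‖ₑ ^ 2 *
        ENNReal.ofReal (Real.exp (-ε * ξ ^ 2))
      ≤ ∫⁻ a, ∫⁻ b, ‖g a‖ₑ * ‖g b‖ₑ *
        ‖∫ ξ : ℝ, cexp ((-ε + I * (τ a - τ b)) * ξ ^ 2 + I * (x a - x b) * ξ + 0)‖ₑ := by
  set e : ℝ → ℝ → ℂ := fun ξ a => cexp (I * (x a * ξ + τ a * ξ ^ 2)) * g a with he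
  set w : ℝ → ℂ := fun ξ => (Real.exp (-ε * ξ ^ 2) : ℂ) with hw
  have hgm := hg.aestronglyMeasurable
  have hwint : Integrable w := (integrable_exp_neg_mul_sq hε).ofReal
  have hgg : Integrable (fun p : ℝ × ℝ => g p.1 * (starRingEnd ℂ) (g p.2)) :=
    hg.mul_prod (f := g) (g := fun b => (starRingEnd ℂ) (g b))
      ((RCLike.conjLIE (K := ℂ)).integrable_comp_iff.2 hg)
  have hnorm : ∀ ξ a : ℝ, ‖cexp (I * (x a * ξ + τ a * ξ ^ 2))‖ = 1 := by
    intro ξ a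
    rw [show I * (x a * ξ + τ a * ξ ^ 2 : ℂ) = ((x a * ξ + τ a * ξ ^ 2 : ℝ) : ℂ) * I by
      push_cast; ring]
    exact norm_exp_ofReal_mul_I _
  set H : ℝ → ℝ × ℝ → ℂ := fun ξ p => w ξ * (e ξ p.1 * (starRingEnd ℂ) (e ξ p.2)) with hH
  have hHint : Integrable (Function.uncurry H) := by
    have h1 : Integrable (fun z : ℝ × (ℝ × ℝ) => w z.1 * (g z.2.1 * (starRingEnd ℂ) (g z.2.2))) :=
      hwint.mul_prod hgg
    have h2 : Function.uncurry H = fun z : ℝ × (ℝ × ℝ) =>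
        (cexp (I * (x z.2.1 * z.1 + τ z.2.1 * z.1 ^ 2)) *
          (starRingEnd ℂ) (cexp (I * (x z.2.2 * z.1 + τ z.2.2 * z.1 ^ 2)))) *
        (w z.1 * (g z.2.1 * (starRingEnd ℂ) (g z.2.2))) := by
      ext z; simp only [Function.uncurry, hH, he, map_mul]; ring
    rw [h2]
    refine h1.bdd_mul (c := 1) ?_ (Filter.Eventually.of_forall fun z => ?_)
    · apply Measurable.aestronglyMeasurable
      have := Complex.continuous_conj.measurable
      fun_prop
    · rw [norm_mul, RCLike.norm_conj, hnorm, hnorm, one_mul]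
  have hG : ∀ ξ, ∫ p, H ξ p = ((‖∫ a, e ξ a‖ ^ 2 * Real.exp (-ε * ξ ^ 2) : ℝ) : ℂ) := by
    intro ξ
    simp only [hH]
    rw [integral_const_mul, Measure.volume_eq_prod, integral_prod_mul (e ξ) (fun b => (starRingEnd ℂ) (e ξ b)),
      integral_conj, Complex.mul_conj, Complex.normSq_eq_norm_sq]
    simp only [hw]; push_cast; ring
  have hGint : Integrable (fun ξ => ∫ p, H ξ p) := hHint.integral_prod_left
  have hGint' : Integrable (fun ξ => ‖∫ a, e ξ a‖ ^ 2 * Real.exp (-ε * ξ ^ 2)) := by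
    have := hGint.re
    simpa only [hG, RCLike.re_to_complex, ofReal_re] using this
  calc _ = ∫⁻ ξ : ℝ, ENNReal.ofReal (‖∫ a, e ξ a‖ ^ 2 * Real.exp (-ε * ξ ^ 2)) := by
        refine lintegral_congr fun ξ => ?_
        rw [ENNReal.ofReal_mul (by positivity), ENNReal.ofReal_pow (by positivity),
          ofReal_norm]
    _ = ENNReal.ofReal (∫ ξ : ℝ, ‖∫ a, e ξ a‖ ^ 2 * Real.exp (-ε * ξ ^ 2)) := by
        rw [ofReal_integral_eq_lintegral_ofReal hGint'
          (Filter.Eventually.of_forall fun ξ => by positivity)]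
    _ = ‖∫ ξ, ∫ p, H ξ p‖ₑ := by
        simp only [hG]
        rw [integral_complex_ofReal, ← ofReal_norm, Complex.norm_real, Real.norm_of_nonneg]
        exact integral_nonneg fun ξ => by positivity
    _ = ‖∫ p, ∫ ξ, H ξ p‖ₑ := by rw [integral_integral_swap hHint]
    _ ≤ ∫⁻ p, ‖∫ ξ, H ξ p‖ₑ := enorm_integral_le_lintegral_enorm _
    _ ≤ ∫⁻ a, ∫⁻ b, ‖∫ ξ, H ξ (a, b)‖ₑ := by
        rw [Measure.volume_eq_prod]; exact lintegral_prod_le _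
    _ = _ := by
        refine lintegral_congr fun a => lintegral_congr fun b => ?_
        rw [← RCLike.enorm_conj (g b), ← enorm_mul, ← enorm_mul, ← integral_const_mul]
        congr 2; ext ξ
        simp only [hH, he, hw, map_mul, ← Complex.exp_conj, ofReal_exp]
        simp only [map_add, map_mul, conj_I, conj_ofReal, map_pow]
        rw [show ∀ A B C D E : ℂ, A * ((B * C) * (D * E)) = C * E * (A * B * D) by intros; ring,
          ← Complex.exp_add, ← Complex.exp_add]
        congr 2; push_cast; ring

theorem lintegral_le_of_gaussian_weight {f : ℝ → ℝ≥0∞} (hf : AEMeasurable f) {B : ℝ≥0∞}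
    (h : ∀ ε : ℝ, 0 < ε → ∫⁻ ξ, f ξ * ENNReal.ofReal (Real.exp (-ε * ξ ^ 2)) ≤ B) :
    ∫⁻ ξ, f ξ ≤ B := by
  have h1 : ∀ ξ : ℝ, Filter.Tendsto
      (fun n : ℕ => f ξ * ENNReal.ofReal (Real.exp (-(1 / ((n : ℝ) + 1)) * ξ ^ 2)))
      Filter.atTop (nhds (f ξ)) := by
    intro ξ
    have : Filter.Tendsto (fun n : ℕ => ENNReal.ofReal (Real.exp (-(1 / ((n : ℝ) + 1)) * ξ ^ 2)))
        Filter.atTop (nhds (ENNReal.ofReal (Real.exp (-0 * ξ ^ 2)))) :=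
      ENNReal.tendsto_ofReal ((Real.continuous_exp.tendsto _).comp
        ((tendsto_one_div_add_atTop_nhds_zero_nat.neg).mul_const _))
    simp only [neg_zero, zero_mul, Real.exp_zero, ENNReal.ofReal_one] at this
    simpa using ENNReal.Tendsto.const_mul (a := f ξ) this (Or.inl one_ne_zero)
  calc ∫⁻ ξ, f ξ = ∫⁻ ξ, Filter.liminf
        (fun n : ℕ => f ξ * ENNReal.ofReal (Real.exp (-(1 / ((n : ℝ) + 1)) * ξ ^ 2)))
        Filter.atTop := lintegral_congr fun ξ => (h1 ξ).liminf_eq.symm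
    _ ≤ Filter.liminf (fun n : ℕ => ∫⁻ ξ, f ξ *
          ENNReal.ofReal (Real.exp (-(1 / ((n : ℝ) + 1)) * ξ ^ 2))) Filter.atTop :=
        lintegral_liminf_le' fun n => hf.mul (by fun_prop)
    _ ≤ Filter.liminf (fun n : ℕ => B) Filter.atTop :=
        Filter.liminf_le_liminf (Filter.Eventually.of_forall fun n => h _ (by positivity))
    _ = B := Filter.liminf_const B

theorem norm_integral_cexp_quadratic {ε : ℝ} (hε : 0 < ε) (σ d : ℝ) :
    ‖∫ ξ : ℝ, cexp ((-ε + I * σ) * ξ ^ 2 + I * d * ξ + 0)‖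
      = (π / ‖(-ε + I * σ : ℂ)‖) ^ (1 / 2 : ℝ) *
        Real.exp (-(ε * d ^ 2) / (4 * (ε ^ 2 + σ ^ 2))) := by
  have hb : (-ε + I * σ : ℂ).re < 0 := by simpa using hε
  rw [integral_cexp_quadratic hb, norm_mul, Complex.norm_exp]
  congr 1
  · rw [show (1 / 2 : ℂ) = ((1 / 2 : ℝ) : ℂ) by push_cast; rfl,
      Complex.norm_cpow_real, norm_div, norm_neg, Complex.norm_real,
      Real.norm_of_nonneg Real.pi_pos.le]
  · congr 1
    have h1 : (4 * (-ε + I * σ) : ℂ) ≠ 0 := by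
      intro h; rw [mul_eq_zero] at h
      rcases h with h | h
      · norm_num at h
      · rw [h] at hb; simp at hb
    have h2 : (0 - (I * d) ^ 2 / (4 * (-ε + I * σ)) : ℂ)
        = ((-(ε * d ^ 2) / (4 * (ε ^ 2 + σ ^ 2)) : ℝ) : ℂ)
          + ((-(σ * d ^ 2) / (4 * (ε ^ 2 + σ ^ 2)) : ℝ) : ℂ) * I := by
      have h3 : (ε ^ 2 + σ ^ 2 : ℂ) ≠ 0 := by
        have : (ε ^ 2 + σ ^ 2 : ℝ) ≠ 0 := by positivity
        exact_mod_cast this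
      push_cast
      rw [zero_sub, ← neg_div, div_eq_iff h1]
      field_simp
      ring_nf
      simp only [I_sq]
      ring
    rw [h2]; simp only [add_re, ofReal_re, mul_re, I_re, I_im, ofReal_im]; ring

theorem enorm_integral_cexp_quadratic_le {ε : ℝ} (hε : 0 < ε) (σ d : ℝ) :
    ‖∫ ξ : ℝ, cexp ((-ε + I * σ) * ξ ^ 2 + I * d * ξ + 0)‖ₑ
      ≤ 2 * ‖σ‖ₑ ^ (-(1 / 2) : ℝ) := by
  rcases eq_or_ne σ 0 with rfl | hσ
  · simp [ENNReal.zero_rpow_of_neg]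
  have h0 : |σ| ≤ ‖(-ε + I * σ : ℂ)‖ := by
    simpa using Complex.abs_im_le_norm (-ε + I * σ : ℂ)
  have hσ' : 0 < |σ| := abs_pos.2 hσ
  have h1 : ‖∫ ξ : ℝ, cexp ((-ε + I * σ) * ξ ^ 2 + I * d * ξ + 0)‖
      ≤ 2 * |σ| ^ (-(1 / 2) : ℝ) := by
    rw [norm_integral_cexp_quadratic hε]
    calc _ ≤ (4 / |σ|) ^ (1 / 2 : ℝ) * 1 := by
          gcongr
          · exact Real.pi_lt_four.le
          · rw [Real.exp_le_one_iff, neg_div, neg_nonpos]; positivity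
      _ = 2 * |σ| ^ (-(1 / 2) : ℝ) := by
          rw [mul_one, Real.div_rpow (by norm_num) hσ'.le, Real.rpow_neg hσ'.le,
            show (4 : ℝ) = 2 ^ (2 : ℝ) by norm_num, ← Real.rpow_mul (by norm_num)]
          norm_num; rfl
  rw [← ofReal_norm, ← ofReal_norm, Real.norm_eq_abs, ENNReal.ofReal_rpow_of_pos hσ',
    show (2 : ℝ≥0∞) = ENNReal.ofReal 2 by norm_num, ← ENNReal.ofReal_mul (by norm_num)]
  exact ENNReal.ofReal_le_ofReal h1

theorem lintegral_enorm_integral_cexp_gaussian {ε : ℝ} (hε : 0 < ε) :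
    ∫⁻ d : ℝ, ‖∫ ξ : ℝ, cexp ((-ε + I * (0 : ℝ)) * ξ ^ 2 + I * d * ξ + 0)‖ₑ
      = ENNReal.ofReal (2 * π) := by
  have h : ∀ d : ℝ, ‖∫ ξ : ℝ, cexp ((-ε + I * (0 : ℝ)) * ξ ^ 2 + I * d * ξ + 0)‖ₑ
      = ENNReal.ofReal (√(π / ε) * Real.exp (-(1 / (4 * ε)) * d ^ 2)) := by
    intro d
    rw [← ofReal_norm, norm_integral_cexp_quadratic hε, Real.sqrt_eq_rpow]
    congr 3
    · simp [abs_of_pos hε]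
    · field_simp; ring
  simp_rw [h]
  rw [← ofReal_integral_eq_lintegral_ofReal
    ((integrable_exp_neg_mul_sq (by positivity)).const_mul _)
    (Filter.Eventually.of_forall fun d => by positivity), integral_const_mul, integral_gaussian,
    ← Real.sqrt_mul (by positivity)]
  congr 1
  rw [show π / ε * (π / (1 / (4 * ε))) = (2 * π) ^ 2 by field_simp; norm_num]
  exact Real.sqrt_sq (by positivity)

theorem aestronglyMeasurable_oscillatory {g : ℝ → ℂ} (hg : AEStronglyMeasurable g) {x τ : ℝ → ℝ}
    (hx : Measurable x) (hτ : Measurable τ) :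
    AEStronglyMeasurable (fun ξ : ℝ => ∫ a, cexp (I * (x a * ξ + τ a * ξ ^ 2)) * g a) := by
  refine AEStronglyMeasurable.integral_prod_right'
    (f := fun p : ℝ × ℝ => cexp (I * (x p.2 * p.1 + τ p.2 * p.1 ^ 2)) * g p.2) ?_
  exact (Measurable.aestronglyMeasurable (by fun_prop)).mul hg.comp_snd

/-- The `L²` bound for the Fourier transform on `L¹`. -/
theorem lintegral_fourier_sq_le_s13 (g : ℝ → ℂ) (hg : Integrable g) (x : ℝ → ℝ)
    (hx : ∀ a b, |x a - x b| = |a - b|) :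
    ∫⁻ ξ : ℝ, ‖∫ a, cexp (I * (x a * ξ)) * g a‖ₑ ^ 2
      ≤ ENNReal.ofReal (2 * π) * ∫⁻ a, ‖g a‖ₑ ^ 2 := by
  have hxm : Measurable x := by
    refine (LipschitzWith.of_dist_le_mul (K := 1) fun a b => ?_).continuous.measurable
    simp [Real.dist_eq, hx]
  have hm := aestronglyMeasurable_oscillatory hg.aestronglyMeasurable hxm
    (measurable_const (a := (0 : ℝ)))
  simp only [ofReal_zero, zero_mul, add_zero] at hm
  refine lintegral_le_of_gaussian_weight (by fun_prop) fun ε hε => ?_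
  have h := lintegral_gaussian_weight g hg x (fun _ => 0) hxm measurable_const hε
  simp only [ofReal_zero, zero_mul, add_zero] at h
  refine h.trans ?_
  set k : ℝ → ℝ≥0∞ := fun d =>
    ‖∫ ξ : ℝ, cexp ((-ε + I * (0 : ℝ)) * ξ ^ 2 + I * d * ξ + 0)‖ₑ with hk
  have hkn : ∀ d, k d = ENNReal.ofReal ((π / ‖(-ε + I * (0 : ℝ) : ℂ)‖) ^ (1 / 2 : ℝ) *
        Real.exp (-(ε * d ^ 2) / (4 * (ε ^ 2 + 0 ^ 2)))) := fun d => by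
    rw [hk, ← norm_integral_cexp_quadratic hε, ofReal_norm]
  have hkm : Measurable k := by
    rw [funext hkn]; fun_prop
  have hkx : ∀ a b : ℝ,
      ‖∫ ξ : ℝ, cexp ((-ε + I * (0 - 0)) * ξ ^ 2 + I * (x a - x b) * ξ)‖ₑ = k (a - b) := by
    intro a b
    trans k (x a - x b)
    · simp [hk]
    · rw [hkn, hkn, ← sq_abs, hx, sq_abs]
  simp_rw [hkx]
  have hgm : AEMeasurable (fun a => ‖g a‖ₑ ^ 2) := hg.aestronglyMeasurable.enorm.pow_const 2
  have h2 : ∀ u v : ℝ≥0∞, 2 * (u * v) ≤ u ^ 2 + v ^ 2 := by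
    intro u v
    wlog h : u ≤ v generalizing u v
    · rw [mul_comm u, add_comm]; exact this v u (le_of_not_ge h)
    obtain ⟨d, rfl⟩ := exists_add_of_le h
    calc 2 * (u * (u + d)) ≤ 2 * (u * (u + d)) + d ^ 2 := le_self_add
      _ = _ := by ring
  have hkneg : ∀ a b, k (a - b) = k (b - a) := fun a b => by
    rw [hkn, hkn]; congr 4; ring
  have h3 : ∫⁻ a, ∫⁻ b, ‖g a‖ₑ ^ 2 * k (a - b) = ENNReal.ofReal (2 * π) * ∫⁻ a, ‖g a‖ₑ ^ 2 := by
    rw [← lintegral_const_mul'' _ hgm]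
    refine lintegral_congr fun a => ?_
    rw [lintegral_const_mul _ (by fun_prop), lintegral_sub_left_eq_self,
      hk, lintegral_enorm_integral_cexp_gaussian hε, mul_comm]
  have h4 : ∫⁻ a, ∫⁻ b, ‖g b‖ₑ ^ 2 * k (a - b) = ENNReal.ofReal (2 * π) * ∫⁻ a, ‖g a‖ₑ ^ 2 := by
    rw [lintegral_lintegral_swap, ← h3]
    · simp_rw [fun a b : ℝ => hkneg a b]
    · exact (hgm.comp_snd).mul (Measurable.aemeasurable (by fun_prop))
  have h5 : 2 * ∫⁻ a, ∫⁻ b, ‖g a‖ₑ * ‖g b‖ₑ * k (a - b)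
      ≤ 2 * (ENNReal.ofReal (2 * π) * ∫⁻ a, ‖g a‖ₑ ^ 2) := by
    rw [two_mul (ENNReal.ofReal (2 * π) * _)]
    nth_rewrite 1 [← h3]
    rw [← h4, ← lintegral_add_left', ← lintegral_const_mul' _ _ (by norm_num)]
    · refine lintegral_mono fun a => ?_
      rw [← lintegral_const_mul' _ _ (by norm_num), ← lintegral_add_left (by fun_prop)]
      refine lintegral_mono fun b => ?_
      rw [← mul_assoc, ← add_mul]
      gcongr
      exact h2 _ _
    · refine AEMeasurable.lintegral_prod_right' (f := fun p : ℝ × ℝ => ‖g p.1‖ₑ ^ 2 * k (p.1 - p.2)) ?_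
      exact hgm.comp_fst.mul (Measurable.aemeasurable (by fun_prop))
  exact (ENNReal.mul_le_mul_iff_right (by norm_num) (by norm_num)).1 h5

theorem lintegral_abs_le_two_mul_Ioi (f : ℝ → ℝ≥0∞) (hf : Measurable f) :
    ∫⁻ s : ℝ, f |s| ≤ 2 * ∫⁻ s in Set.Ioi 0, f s := by
  have h1 : ∫⁻ s in Set.Ioi (0 : ℝ), f |s| = ∫⁻ s in Set.Ioi 0, f s :=
    setLIntegral_congr_fun measurableSet_Ioi fun s hs => by simp only [abs_of_pos (Set.mem_Ioi.1 hs)]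
  have h2 : ∫⁻ s in Set.Iic (0 : ℝ), f |s| = ∫⁻ s in Set.Ioi 0, f s := by
    rw [← setLIntegral_congr Iio_ae_eq_Iic, ← h1]
    have := (Measure.measurePreserving_neg (volume : Measure ℝ)).setLIntegral_comp_preimage
      (s := Set.Ioi (0 : ℝ)) (f := fun s => f |s|) measurableSet_Ioi (by fun_prop)
    simpa using this
  rw [← lintegral_add_compl _ (measurableSet_Ioi (a := (0 : ℝ))), Set.compl_Ioi, h1, h2, two_mul]

theorem lintegral_near_kernel {R : ℝ} (hR : 0 < R) :
    ∫⁻ s : ℝ, (if |s| ≤ R then ‖s‖ₑ ^ (-(1 / 2) : ℝ) else 0)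
      ≤ 4 * ENNReal.ofReal R ^ (1 / 2 : ℝ) := by
  have h := lintegral_abs_le_two_mul_Ioi
    (fun s => if s ≤ R then ‖s‖ₑ ^ (-(1 / 2) : ℝ) else 0)
    (Measurable.ite measurableSet_Iic (by fun_prop) measurable_const)
  simp only [Real.enorm_abs] at h
  refine h.trans ?_
  have h1 : ∫⁻ s in Set.Ioi (0 : ℝ), (if s ≤ R then ‖s‖ₑ ^ (-(1 / 2) : ℝ) else 0)
      = ∫⁻ s in Set.Ioc 0 R, ENNReal.ofReal (s ^ (-(1 / 2) : ℝ)) := by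
    rw [← lintegral_indicator measurableSet_Ioi, ← lintegral_indicator measurableSet_Ioc]
    refine lintegral_congr fun s => ?_
    by_cases hs : 0 < s
    · by_cases hs' : s ≤ R
      · simp [Set.indicator, hs, hs', ← ENNReal.ofReal_rpow_of_pos hs, Real.enorm_of_nonneg hs.le]
      · simp [Set.indicator, hs, hs']
    · simp [Set.indicator, hs]
  have hphase : IntervalIntegrable (fun s : ℝ => s ^ (-(1 / 2) : ℝ)) volume 0 R :=
    intervalIntegral.intervalIntegrable_rpow' (by norm_num)
  rw [h1, ← ofReal_integral_eq_lintegral_ofReal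
    ((intervalIntegrable_iff_integrableOn_Ioc_of_le hR.le).1 hphase)
    ((ae_restrict_mem measurableSet_Ioc).mono fun s hs => Real.rpow_nonneg hs.1.le _),
    ← intervalIntegral.integral_of_le hR.le, integral_rpow (Or.inl (by norm_num)),
    ENNReal.ofReal_rpow_of_pos hR,
    show (2 : ℝ≥0∞) = ENNReal.ofReal 2 by norm_num, show (4 : ℝ≥0∞) = ENNReal.ofReal 4 by norm_num,
    ← ENNReal.ofReal_mul (by norm_num), ← ENNReal.ofReal_mul (by norm_num)]
  refine ENNReal.ofReal_le_ofReal (le_of_eq ?_)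
  rw [Real.zero_rpow (by norm_num)]; norm_num; ring

theorem lintegral_far_kernel {R : ℝ} (hR : 0 < R) :
    ∫⁻ s : ℝ, (if |s| ≤ R then 0 else ‖s‖ₑ ^ (-(1 / 2) : ℝ)) ^ (4 : ℝ)
      ≤ 2 * ENNReal.ofReal R ^ (-1 : ℝ) := by
  have h := lintegral_abs_le_two_mul_Ioi
    (fun s => (if s ≤ R then 0 else ‖s‖ₑ ^ (-(1 / 2) : ℝ)) ^ (4 : ℝ))
    ((Measurable.ite measurableSet_Iic measurable_const (by fun_prop)).pow_const _)
  simp only [Real.enorm_abs] at h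
  refine h.trans ?_
  have h1 : ∫⁻ s in Set.Ioi (0 : ℝ), (if s ≤ R then 0 else ‖s‖ₑ ^ (-(1 / 2) : ℝ)) ^ (4 : ℝ)
      = ∫⁻ s in Set.Ioi R, ENNReal.ofReal (s ^ (-2 : ℝ)) := by
    rw [← lintegral_indicator measurableSet_Ioi, ← lintegral_indicator measurableSet_Ioi]
    refine lintegral_congr fun s => ?_
    by_cases hs' : s ≤ R
    · simp [Set.indicator, hs']
    · have hs : 0 < s := hR.trans (not_le.1 hs')
      rw [Set.indicator_of_mem (Set.mem_Ioi.2 hs), Set.indicator_of_mem (Set.mem_Ioi.2 (not_le.1 hs')),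
        if_neg hs', ← ENNReal.ofReal_rpow_of_pos hs, Real.enorm_of_nonneg hs.le, ← ENNReal.rpow_mul]
      norm_num
  rw [h1, ← ofReal_integral_eq_lintegral_ofReal
    (integrableOn_Ioi_rpow_of_lt (by norm_num) hR)
    ((ae_restrict_mem measurableSet_Ioi).mono fun s hs => Real.rpow_nonneg (hR.trans hs).le _),
    integral_Ioi_rpow_of_lt (by norm_num) hR, ENNReal.ofReal_rpow_of_pos hR]
  norm_num

theorem lintegral_min_mul_kernel_le {g : ℝ → ℝ≥0∞} (hg : AEMeasurable g) (t : ℝ) {a : ℝ≥0∞}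
    (ha : a ≠ ∞) (h0 : ∫⁻ s, g s ^ (4 / 3 : ℝ) ≠ 0) (htop : ∫⁻ s, g s ^ (4 / 3 : ℝ) ≠ ∞) :
    ∫⁻ s, min (g s) a * ‖t - s‖ₑ ^ (-(1 / 2) : ℝ)
      ≤ 6 * (∫⁻ s, g s ^ (4 / 3 : ℝ)) ^ (1 / 2 : ℝ) * a ^ (1 / 3 : ℝ) := by
  rcases eq_or_ne a 0 with rfl | ha0
  · simp
  set m := ∫⁻ s, g s ^ (4 / 3 : ℝ) with hm
  obtain ⟨R, hR, hRe⟩ : ∃ R : ℝ, 0 < R ∧ ENNReal.ofReal R = m * a ^ (-(4 / 3) : ℝ) := by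
    have h1 : m * a ^ (-(4 / 3) : ℝ) ≠ ∞ :=
      ENNReal.mul_ne_top htop (ENNReal.rpow_ne_top_of_ne_zero ha0 ha)
    have h2 : m * a ^ (-(4 / 3) : ℝ) ≠ 0 := by
      simp [h0, ha, ha0]
    exact ⟨_, ENNReal.toReal_pos h2 h1, ENNReal.ofReal_toReal h1⟩
  have hsplit : ∀ s, min (g s) a * ‖t - s‖ₑ ^ (-(1 / 2) : ℝ)
      ≤ a * (if |t - s| ≤ R then ‖t - s‖ₑ ^ (-(1 / 2) : ℝ) else 0)
        + (g * fun s => if |t - s| ≤ R then 0 else ‖t - s‖ₑ ^ (-(1 / 2) : ℝ)) s := by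
    intro s
    simp only [Pi.mul_apply]
    split_ifs
    · simp only [mul_zero, add_zero]; gcongr; exact min_le_right _ _
    · simp only [mul_zero, zero_add]; gcongr; exact min_le_left _ _
  have hmk1 : Measurable fun s : ℝ => if |s| ≤ R then ‖s‖ₑ ^ (-(1 / 2) : ℝ) else 0 :=
    Measurable.ite (measurableSet_le (by fun_prop) measurable_const) (by fun_prop) measurable_const
  have hmk2 : Measurable fun s : ℝ => if |s| ≤ R then 0 else ‖s‖ₑ ^ (-(1 / 2) : ℝ) :=
    Measurable.ite (measurableSet_le (by fun_prop) measurable_const) measurable_const (by fun_prop)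
  have hmk1' : Measurable fun s : ℝ => if |t - s| ≤ R then ‖t - s‖ₑ ^ (-(1 / 2) : ℝ) else 0 :=
    hmk1.comp (measurable_const.sub measurable_id)
  have hmk2' : Measurable fun s : ℝ => if |t - s| ≤ R then 0 else ‖t - s‖ₑ ^ (-(1 / 2) : ℝ) :=
    hmk2.comp (measurable_const.sub measurable_id)
  have hconj : (4 / 3 : ℝ).HolderConjugate 4 := by
    rw [Real.holderConjugate_iff]; norm_num
  have hnear : ∫⁻ s, a * (if |t - s| ≤ R then ‖t - s‖ₑ ^ (-(1 / 2) : ℝ) else 0)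
      ≤ 4 * (m ^ (1 / 2 : ℝ) * a ^ (1 / 3 : ℝ)) := by
    rw [lintegral_const_mul _ hmk1',
      lintegral_sub_left_eq_self (fun s : ℝ => if |s| ≤ R then ‖s‖ₑ ^ (-(1 / 2) : ℝ) else 0) t]
    calc _ ≤ a * (4 * ENNReal.ofReal R ^ (1 / 2 : ℝ)) := by gcongr; exact lintegral_near_kernel hR
      _ = 4 * (m ^ (1 / 2 : ℝ) * (a ^ (1 : ℝ) * a ^ (-(2 / 3) : ℝ))) := by
          rw [hRe, ENNReal.mul_rpow_of_nonneg _ _ (by norm_num), ← ENNReal.rpow_mul,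
            ENNReal.rpow_one]
          norm_num; ring
      _ = _ := by rw [← ENNReal.rpow_add _ _ ha0 ha]; norm_num
  have hfar : ∫⁻ s, (g * fun s => if |t - s| ≤ R then 0 else ‖t - s‖ₑ ^ (-(1 / 2) : ℝ)) s
      ≤ 2 * (m ^ (1 / 2 : ℝ) * a ^ (1 / 3 : ℝ)) := by
    refine (ENNReal.lintegral_mul_le_Lp_mul_Lq _ hconj hg hmk2'.aemeasurable).trans ?_
    rw [lintegral_sub_left_eq_self
      (fun s : ℝ => (if |s| ≤ R then 0 else ‖s‖ₑ ^ (-(1 / 2) : ℝ)) ^ (4 : ℝ)) t]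
    calc _ ≤ m ^ (1 / (4 / 3) : ℝ) * (2 * ENNReal.ofReal R ^ (-1 : ℝ)) ^ (1 / 4 : ℝ) := by
          gcongr; exact lintegral_far_kernel hR
      _ = 2 ^ (1 / 4 : ℝ) * ((m ^ (3 / 4 : ℝ) * m ^ (-(1 / 4) : ℝ)) * a ^ (1 / 3 : ℝ)) := by
          rw [hRe, ENNReal.mul_rpow_of_nonneg _ _ (by norm_num), ← ENNReal.rpow_mul,
            ENNReal.mul_rpow_of_ne_zero h0 (by simp [ha, ha0]), ← ENNReal.rpow_mul]
          norm_num; ring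
      _ ≤ 2 ^ (1 : ℝ) * ((m ^ (3 / 4 : ℝ) * m ^ (-(1 / 4) : ℝ)) * a ^ (1 / 3 : ℝ)) := by
          gcongr <;> norm_num
      _ = _ := by rw [← ENNReal.rpow_add _ _ h0 htop]; norm_num
  calc _ ≤ _ := lintegral_mono hsplit
    _ = _ := lintegral_add_left (hmk1'.const_mul a) _
    _ ≤ _ := add_le_add hnear hfar
    _ = _ := by ring

/-- The diagonal Hardy–Littlewood–Sobolev inequality on the line with kernel `|t - s|^{-1/2}`. -/
theorem lintegral_hardyLittlewoodSobolev_le {g : ℝ → ℝ≥0∞} (hg : AEMeasurable g)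
    (hfin : ∀ t, g t ≠ ∞) :
    ∫⁻ t, ∫⁻ s, g t * g s * ‖t - s‖ₑ ^ (-(1 / 2) : ℝ)
      ≤ 12 * (∫⁻ s, g s ^ (4 / 3 : ℝ)) ^ (3 / 2 : ℝ) := by
  set m := ∫⁻ s, g s ^ (4 / 3 : ℝ) with hm
  rcases eq_or_ne m 0 with h0 | h0
  · have hg0 : ∀ᵐ t, g t = 0 := by
      have := (lintegral_eq_zero_iff' (hg.pow_const (4 / 3 : ℝ))).1 h0
      filter_upwards [this] with t ht
      exact (ENNReal.rpow_eq_zero_iff_of_pos (by norm_num)).1 ht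
    have : ∫⁻ t, ∫⁻ s, g t * g s * ‖t - s‖ₑ ^ (-(1 / 2) : ℝ) = 0 := by
      rw [lintegral_congr_ae (g := fun _ => 0) ?_, lintegral_zero]
      filter_upwards [hg0] with t ht
      simp [ht]
    exact this.trans_le zero_le
  rcases eq_or_ne m ∞ with htop | htop
  · simp [htop]
  have hk : Measurable fun p : ℝ × ℝ => ‖p.1 - p.2‖ₑ ^ (-(1 / 2) : ℝ) := by fun_prop
  have hmin : AEMeasurable fun p : ℝ × ℝ =>
      g p.1 * (min (g p.2) (g p.1) * ‖p.1 - p.2‖ₑ ^ (-(1 / 2) : ℝ)) :=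
    hg.comp_fst.mul ((hg.comp_snd.min hg.comp_fst).mul hk.aemeasurable)
  have hhalf : ∫⁻ t, ∫⁻ s, g t * (min (g s) (g t) * ‖t - s‖ₑ ^ (-(1 / 2) : ℝ))
      ≤ 6 * m ^ (3 / 2 : ℝ) := by
    calc _ ≤ ∫⁻ t, 6 * m ^ (1 / 2 : ℝ) * g t ^ (4 / 3 : ℝ) := by
          refine lintegral_mono fun t => ?_
          rw [lintegral_const_mul' _ _ (hfin t)]
          refine (mul_le_mul_right (lintegral_min_mul_kernel_le hg t (hfin t) h0 htop) _).trans ?_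
          rw [← hm]
          have : g t ^ (4 / 3 : ℝ) = g t * g t ^ (1 / 3 : ℝ) := by
            nth_rewrite 2 [← ENNReal.rpow_one (g t)]
            rw [← ENNReal.rpow_add_of_nonneg _ _ (by norm_num) (by norm_num)]; norm_num
          rw [this]
          exact le_of_eq (by ring)
      _ = 6 * (m ^ (1 / 2 : ℝ) * m ^ (1 : ℝ)) := by
          rw [lintegral_const_mul'' _ (hg.pow_const _), ← hm, ENNReal.rpow_one, mul_assoc]
      _ = _ := by rw [← ENNReal.rpow_add _ _ h0 htop]; norm_num
  have hpt : ∀ t s, g t * g s * ‖t - s‖ₑ ^ (-(1 / 2) : ℝ)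
      ≤ g t * (min (g s) (g t) * ‖t - s‖ₑ ^ (-(1 / 2) : ℝ))
        + g s * (min (g t) (g s) * ‖s - t‖ₑ ^ (-(1 / 2) : ℝ)) := by
    intro t s
    rw [enorm_sub_rev s t]
    rcases le_total (g s) (g t) with h | h
    · rw [min_eq_left h, mul_assoc]; exact le_self_add
    · rw [min_eq_left h, mul_assoc, mul_left_comm]; exact le_add_self
  calc _ ≤ ∫⁻ t, ∫⁻ s, (g t * (min (g s) (g t) * ‖t - s‖ₑ ^ (-(1 / 2) : ℝ))
        + g s * (min (g t) (g s) * ‖s - t‖ₑ ^ (-(1 / 2) : ℝ))) :=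
        lintegral_mono fun t => lintegral_mono fun s => hpt t s
    _ = (∫⁻ t, ∫⁻ s, g t * (min (g s) (g t) * ‖t - s‖ₑ ^ (-(1 / 2) : ℝ)))
        + ∫⁻ t, ∫⁻ s, g s * (min (g t) (g s) * ‖s - t‖ₑ ^ (-(1 / 2) : ℝ)) := by
        rw [← lintegral_add_left' hmin.lintegral_prod_right']
        refine lintegral_congr fun t => ?_
        rw [lintegral_add_left' ?_]
        have : AEMeasurable (fun s => min (g s) (g t)) := hg.min aemeasurable_const
        exact (this.mul (Measurable.aemeasurable (by fun_prop))).const_mul _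
    _ = 2 * ∫⁻ t, ∫⁻ s, g t * (min (g s) (g t) * ‖t - s‖ₑ ^ (-(1 / 2) : ℝ)) := by
        rw [lintegral_lintegral_swap (f := fun t s =>
          g s * (min (g t) (g s) * ‖s - t‖ₑ ^ (-(1 / 2) : ℝ))) hmin.prod_swap, two_mul]
    _ ≤ 2 * (6 * m ^ (3 / 2 : ℝ)) := by gcongr
    _ = _ := by ring

/-- The extension operator of the parabola: the one-dimensional Schrödinger evolution at `(t, x)`
of the data with frequency profile `φ`. -/
def parabolaExtension (φ : ℝ → ℂ) (t x : ℝ) : ℂ :=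
  ∫ ξ : ℝ, cexp (I * (x * ξ + (-t : ℝ) * ξ ^ 2)) * φ ξ

theorem norm_cexp_phase (x t ξ : ℝ) : ‖cexp (I * (x * ξ + t * ξ ^ 2))‖ = 1 := by
  rw [show I * (x * ξ + t * ξ ^ 2 : ℂ) = ((x * ξ + t * ξ ^ 2 : ℝ) : ℂ) * I by push_cast; ring]
  exact norm_exp_ofReal_mul_I _

theorem norm_parabolaExtension_le (φ : ℝ → ℂ) (t x : ℝ) :
    ‖parabolaExtension φ t x‖ ≤ ∫ ξ, ‖φ ξ‖ := by
  refine (norm_integral_le_integral_norm _).trans (le_of_eq ?_)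
  simp only [norm_mul, norm_cexp_phase, one_mul]

theorem continuous_parabolaExtension {φ : ℝ → ℂ} (hφ : Integrable φ) :
    Continuous fun p : ℝ × ℝ => parabolaExtension φ p.1 p.2 := by
  refine continuous_of_dominated (bound := fun ξ => ‖φ ξ‖)
    (fun p => (Measurable.aestronglyMeasurable (by fun_prop)).mul hφ.aestronglyMeasurable)
    (fun p => Filter.Eventually.of_forall fun ξ => ?_) hφ.norm
    (Filter.Eventually.of_forall fun ξ => by fun_prop)
  rw [norm_mul, norm_cexp_phase, one_mul]

/-- The estimate dual to the `L⁴L^∞` Strichartz inequality along a measurable curve. -/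
theorem lintegral_dual_strichartz_le {g : ℝ → ℂ} (hg : Integrable g) {x : ℝ → ℝ}
    (hx : Measurable x) :
    ∫⁻ ξ : ℝ, ‖∫ t : ℝ, cexp (I * (x t * ξ + (-t : ℝ) * ξ ^ 2)) * g t‖ₑ ^ 2
      ≤ 24 * (∫⁻ t, ‖g t‖ₑ ^ (4 / 3 : ℝ)) ^ (3 / 2 : ℝ) := by
  have hm := aestronglyMeasurable_oscillatory hg.aestronglyMeasurable hx
    (measurable_neg (G := ℝ))
  refine lintegral_le_of_gaussian_weight (by fun_prop) fun ε hε => ?_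
  calc _ ≤ _ := lintegral_gaussian_weight g hg x (fun t => -t) hx measurable_neg hε
    _ ≤ ∫⁻ t, ∫⁻ s, 2 * (‖g t‖ₑ * ‖g s‖ₑ * ‖t - s‖ₑ ^ (-(1 / 2) : ℝ)) := by
        refine lintegral_mono fun t => lintegral_mono fun s => ?_
        have h := enorm_integral_cexp_quadratic_le hε (-t - -s) (x t - x s)
        rw [show -t - -s = -(t - s) by ring, enorm_neg] at h
        refine (mul_le_mul_right (le_trans (le_of_eq ?_) h) _).trans (le_of_eq (by ring))
        push_cast
        congr 3; ext ξ; congr 4; ring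
    _ = 2 * ∫⁻ t, ∫⁻ s, ‖g t‖ₑ * ‖g s‖ₑ * ‖t - s‖ₑ ^ (-(1 / 2) : ℝ) := by
        simp_rw [lintegral_const_mul' (2 : ℝ≥0∞) _ (by norm_num)]
    _ ≤ 2 * (12 * (∫⁻ t, ‖g t‖ₑ ^ (4 / 3 : ℝ)) ^ (3 / 2 : ℝ)) := by
        gcongr
        exact lintegral_hardyLittlewoodSobolev_le hg.aestronglyMeasurable.enorm
          fun t => enorm_ne_top
    _ = _ := by ring

theorem setLIntegral_parabolaExtension_pow_four_le {φ : ℝ → ℂ} (hφ : Integrable φ) {x : ℝ → ℝ}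
    (hx : Measurable x) {E : Set ℝ} (hE : MeasurableSet E) (hEfin : volume E ≠ ∞) :
    ∫⁻ t in E, ‖parabolaExtension φ t (x t)‖ₑ ^ 4 ≤ 576 * (∫⁻ ξ, ‖φ ξ‖ₑ ^ 2) ^ 2 := by
  set v : ℝ → ℂ := fun t => parabolaExtension φ t (x t) with hv
  have hvm : Measurable v := by
    have := (continuous_parabolaExtension hφ).measurable.comp (measurable_id'.prodMk hx)
    simpa only [Function.comp_def] using this
  set c := ∫ ξ, ‖φ ξ‖ with hc
  have hvc : ∀ t, ‖v t‖ ≤ c := fun t => norm_parabolaExtension_le φ t (x t)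
  set g : ℝ → ℂ := E.indicator fun t => (‖v t‖ : ℂ) ^ 2 * (starRingEnd ℂ) (v t) with hg
  have hgint : Integrable g := by
    refine (integrable_indicator_iff hE).2 ?_
    refine Measure.integrableOn_of_bounded (M := c ^ 2 * c) hEfin ?_
      (Filter.Eventually.of_forall fun t => ?_)
    · have := Complex.continuous_conj.measurable
      exact Measurable.aestronglyMeasurable (by fun_prop)
    · rw [norm_mul, RCLike.norm_conj, norm_pow, Complex.norm_real, norm_norm]
      have := hvc t
      gcongr
  set A := ∫⁻ t in E, ‖v t‖ₑ ^ 4 with hA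
  have hAfin : A ≠ ∞ := by
    refine ne_top_of_le_ne_top ?_ (setLIntegral_mono_ae (g := fun _ => ENNReal.ofReal c ^ 4)
      aemeasurable_const (Filter.Eventually.of_forall fun t _ => ?_))
    · rw [setLIntegral_const]
      exact ENNReal.mul_ne_top (by simp) hEfin
    · rw [← ofReal_norm]; gcongr; exact hvc t
  have hgA : ∫⁻ t, ‖g t‖ₑ ^ (4 / 3 : ℝ) = A := by
    rw [hA, ← lintegral_indicator hE]
    refine lintegral_congr fun t => ?_
    by_cases ht : t ∈ E
    · simp only [hg, Set.indicator_of_mem ht]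
      rw [enorm_mul, enorm_pow, RCLike.enorm_conj, ← ofReal_norm (‖v t‖ : ℂ), Complex.norm_real,
        norm_norm, ofReal_norm, ← pow_succ, ← ENNReal.rpow_natCast, ← ENNReal.rpow_mul,
        ← ENNReal.rpow_natCast]
      norm_num
    · simp [hg, Set.indicator_of_notMem ht]
  set G : ℝ → ℂ := fun ξ => ∫ t : ℝ, cexp (I * (x t * ξ + (-t : ℝ) * ξ ^ 2)) * g t with hG
  have hgv : ∀ t, ‖v t * g t‖ₑ = E.indicator (fun t => ‖v t‖ₑ ^ 4) t := by
    intro t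
    by_cases ht : t ∈ E
    · simp only [hg, Set.indicator_of_mem ht]
      rw [enorm_mul, enorm_mul, enorm_pow, RCLike.enorm_conj, ← ofReal_norm (‖v t‖ : ℂ),
        Complex.norm_real, norm_norm, ofReal_norm]
      ring
    · simp [hg, Set.indicator_of_notMem ht]
  have hgv' : ∀ t, v t * g t = ((E.indicator (fun t => ‖v t‖ ^ 4) t : ℝ) : ℂ) := by
    intro t
    by_cases ht : t ∈ E
    · simp only [hg, Set.indicator_of_mem ht]
      rw [mul_left_comm, Complex.mul_conj, Complex.normSq_eq_norm_sq]
      push_cast; ring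
    · simp [hg, Set.indicator_of_notMem ht]
  have hnn : ∀ t, 0 ≤ E.indicator (fun t => ‖v t‖ ^ 4) t :=
    fun t => Set.indicator_nonneg (fun _ _ => by positivity) t
  have hvgint : Integrable fun t => v t * g t :=
    hgint.bdd_mul (c := c) hvm.aestronglyMeasurable (Filter.Eventually.of_forall hvc)
  have hAeq : A = ‖∫ t, v t * g t‖ₑ := by
    have h1 : Integrable fun t => E.indicator (fun t => ‖v t‖ ^ 4) t := by
      have := hvgint.re
      simpa only [hgv', RCLike.re_to_complex, ofReal_re] using this
    simp only [hgv']
    rw [integral_complex_ofReal, ← ofReal_norm, Complex.norm_real,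
      Real.norm_of_nonneg (integral_nonneg hnn),
      ofReal_integral_eq_lintegral_ofReal h1 (Filter.Eventually.of_forall hnn), hA,
      ← lintegral_indicator hE]
    refine lintegral_congr fun t => ?_
    by_cases ht : t ∈ E
    · simp [Set.indicator_of_mem ht, ENNReal.ofReal_pow]
    · simp [Set.indicator_of_notMem ht]
  have hswap : ∫ t, v t * g t = ∫ ξ, φ ξ * G ξ := by
    have hphase : Integrable (Function.uncurry fun (t ξ : ℝ) =>
        cexp (I * (x t * ξ + (-t : ℝ) * ξ ^ 2)) * (g t * φ ξ)) := by
      refine (hgint.mul_prod hφ).bdd_mul (c := 1) (Measurable.aestronglyMeasurable (by fun_prop))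
        (Filter.Eventually.of_forall fun p => (norm_cexp_phase _ _ _).le)
    calc _ = ∫ t, ∫ ξ : ℝ, cexp (I * (x t * ξ + (-t : ℝ) * ξ ^ 2)) * (g t * φ ξ) := by
          congr 1; ext t
          simp only [hv, parabolaExtension]
          rw [← integral_mul_const]
          congr 1; ext ξ; ring
      _ = ∫ ξ : ℝ, ∫ t, cexp (I * (x t * ξ + (-t : ℝ) * ξ ^ 2)) * (g t * φ ξ) :=
          integral_integral_swap hphase
      _ = _ := by
          congr 1; ext ξ
          simp only [hG]
          rw [← integral_const_mul]
          congr 1; ext t; ring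
  have hGm : AEStronglyMeasurable G :=
    aestronglyMeasurable_oscillatory hgint.aestronglyMeasurable hx (measurable_neg (G := ℝ))
  have hCS : A ≤ (∫⁻ ξ, ‖φ ξ‖ₑ ^ 2) ^ (1 / 2 : ℝ) * (24 * A ^ (3 / 2 : ℝ)) ^ (1 / 2 : ℝ) := by
    have hconj : (2 : ℝ).HolderConjugate 2 := by rw [Real.holderConjugate_iff]; norm_num
    have hH := ENNReal.lintegral_mul_le_Lp_mul_Lq volume hconj hφ.aestronglyMeasurable.enorm
      hGm.enorm
    simp only [ENNReal.rpow_two] at hH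
    calc A = ‖∫ ξ, φ ξ * G ξ‖ₑ := by rw [hAeq, hswap]
      _ ≤ ∫⁻ ξ, ‖φ ξ * G ξ‖ₑ := enorm_integral_le_lintegral_enorm _
      _ = ∫⁻ ξ, ((fun ξ => ‖φ ξ‖ₑ) * fun ξ => ‖G ξ‖ₑ) ξ := by simp
      _ ≤ _ := hH
      _ ≤ _ := by
          gcongr
          rw [← hgA]
          exact lintegral_dual_strichartz_le hgint hx
  rcases eq_or_ne A 0 with h0 | h0
  · exact h0.trans_le zero_le
  set P := ∫⁻ ξ, ‖φ ξ‖ₑ ^ 2 with hP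
  have h1 : A ^ (1 / 4 : ℝ) ≤ (24 * P) ^ (1 / 2 : ℝ) := by
    have hA34 : A ^ (3 / 4 : ℝ) ≠ 0 := by simp [h0, hAfin]
    have hA34' : A ^ (3 / 4 : ℝ) ≠ ∞ := ENNReal.rpow_ne_top_of_nonneg (by norm_num) hAfin
    refine (ENNReal.mul_le_mul_iff_right hA34 hA34').1 ?_
    rw [← ENNReal.rpow_add _ _ h0 hAfin]
    norm_num
    refine hCS.trans (le_of_eq ?_)
    rw [ENNReal.mul_rpow_of_nonneg _ _ (by norm_num), ENNReal.mul_rpow_of_nonneg _ _ (by norm_num),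
      ← ENNReal.rpow_mul]
    norm_num
    ring
  calc A = (A ^ (1 / 4 : ℝ)) ^ (4 : ℝ) := by rw [← ENNReal.rpow_mul]; norm_num
    _ ≤ ((24 * P) ^ (1 / 2 : ℝ)) ^ (4 : ℝ) := by gcongr
    _ = (24 * P) ^ 2 := by rw [← ENNReal.rpow_mul, ← ENNReal.rpow_natCast]; norm_num
    _ = _ := by rw [mul_pow]; norm_num

theorem lintegral_parabolaExtension_pow_four_le {φ : ℝ → ℂ} (hφ : Integrable φ) {x : ℝ → ℝ}
    (hx : Measurable x) :
    ∫⁻ t, ‖parabolaExtension φ t (x t)‖ₑ ^ 4 ≤ 576 * (∫⁻ ξ, ‖φ ξ‖ₑ ^ 2) ^ 2 := by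
  rw [← setLIntegral_univ, ← iUnion_spanningSets (volume : Measure ℝ),
    setLIntegral_iUnion_of_directed _ (monotone_spanningSets _).directed_le]
  exact iSup_le fun n => setLIntegral_parabolaExtension_pow_four_le hφ hx
    (measurableSet_spanningSets _ n) (measure_spanningSets_lt_top _ n).ne

/-- A bound along all measurable curves bounds the supremum over rational points. -/
theorem lintegral_iSup_rat_le {N : ℝ → ℝ → ℝ≥0∞} (hN : Measurable (Function.uncurry N))
    {B : ℝ≥0∞} (h : ∀ x : ℝ → ℝ, Measurable x → ∫⁻ t, N t (x t) ≤ B) :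
    ∫⁻ t, ⨆ q : ℚ, N t q ≤ B := by
  obtain ⟨r, hr⟩ := exists_surjective_nat ℚ
  let X : ℕ → ℝ → ℝ := fun n => Nat.rec (fun _ => (r 0 : ℝ))
    (fun n X t => if N t (X t) < N t (r (n + 1)) then (r (n + 1) : ℝ) else X t) n
  have hX0 : ∀ t, X 0 t = r 0 := fun _ => rfl
  have hXs : ∀ n, X (n + 1) =
      fun t => if N t (X n t) < N t (r (n + 1)) then (r (n + 1) : ℝ) else X n t := fun _ => rfl
  have hXm : ∀ n, Measurable (X n) := by
    intro n
    induction n with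
    | zero => exact measurable_const
    | succ n ih =>
      rw [hXs]
      refine Measurable.ite (measurableSet_lt ?_ ?_) measurable_const ih
      · exact hN.comp (measurable_id.prodMk ih)
      · exact hN.comp (measurable_id.prodMk measurable_const)
  have hstep : ∀ n t, N t (X n t) ≤ N t (X (n + 1) t) ∧ N t (r (n + 1)) ≤ N t (X (n + 1) t) := by
    intro n t
    simp only [hXs]
    split_ifs with h
    · exact ⟨h.le, le_rfl⟩
    · exact ⟨le_rfl, not_lt.1 h⟩
  have hle : ∀ t, ⨆ q : ℚ, N t q ≤ ⨆ n, N t (X n t) := by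
    refine fun t => iSup_le fun q => ?_
    obtain ⟨n, rfl⟩ := hr q
    refine le_iSup_of_le (f := fun n => N t (X n t)) n ?_
    cases n with
    | zero => rw [hX0]
    | succ n => exact (hstep n t).2
  calc _ ≤ ∫⁻ t, ⨆ n, N t (X n t) := lintegral_mono hle
    _ = ⨆ n, ∫⁻ t, N t (X n t) :=
        lintegral_iSup (fun n => hN.comp (measurable_id.prodMk (hXm n)))
          (monotone_nat_of_le_succ fun n t => (hstep n t).1)
    _ ≤ B := iSup_le fun n => h _ (hXm n)

/-- The one-dimensional `L⁴L^∞` Strichartz inequality, with the supremum over rational points. -/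
theorem lintegral_iSup_parabolaExtension_le {φ : ℝ → ℂ} (hφ : Integrable φ) :
    ∫⁻ t, (⨆ q : ℚ, ‖parabolaExtension φ t q‖ₑ ^ 2) ^ 2 ≤ 576 * (∫⁻ ξ, ‖φ ξ‖ₑ ^ 2) ^ 2 := by
  simp_rw [ENNReal.iSup_pow, ← pow_mul]
  exact lintegral_iSup_rat_le (N := fun t x => ‖parabolaExtension φ t x‖ₑ ^ 4)
    ((continuous_parabolaExtension hφ).measurable.enorm.pow_const 4)
    fun x hx => lintegral_parabolaExtension_pow_four_le hφ hx

/-- Minkowski's integral inequality in `L²`, with the inner norms bounded by `s`. -/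
theorem lintegral_lintegral_sq_le {a : ℝ → ℝ → ℝ≥0∞} (ha : Measurable (Function.uncurry a))
    {s : ℝ → ℝ≥0∞} (h : ∀ᵐ η, ∫⁻ t, a t η ^ 2 ≤ s η ^ 2) :
    ∫⁻ t, (∫⁻ η, a t η) ^ 2 ≤ (∫⁻ η, s η) ^ 2 := by
  have hconj : (2 : ℝ).HolderConjugate 2 := by rw [Real.holderConjugate_iff]; norm_num
  have ht : ∀ η, Measurable fun t => a t η := fun η => ha.of_uncurry_right
  have hη : ∀ t, Measurable (a t) := fun t => ha.of_uncurry_left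
  have hroot : ∀ᵐ η, (∫⁻ t, a t η ^ (2 : ℝ)) ^ (1 / 2 : ℝ) ≤ s η := by
    filter_upwards [h] with η hη
    calc _ ≤ (s η ^ (2 : ℝ)) ^ (1 / 2 : ℝ) := by
          simp only [ENNReal.rpow_two]; gcongr
      _ = s η := by rw [← ENNReal.rpow_mul]; norm_num
  have hCS : ∀ η η', ∫⁻ t, a t η * a t η' ≤
      (∫⁻ t, a t η ^ (2 : ℝ)) ^ (1 / 2 : ℝ) * (∫⁻ t, a t η' ^ (2 : ℝ)) ^ (1 / 2 : ℝ) :=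
    fun η η' => ENNReal.lintegral_mul_le_Lp_mul_Lq _ hconj (ht η).aemeasurable (ht η').aemeasurable
  set T : ℝ → ℝ≥0∞ := fun η => (∫⁻ t, a t η ^ (2 : ℝ)) ^ (1 / 2 : ℝ) with hT
  have hTm : Measurable T :=
    (Measurable.lintegral_prod_left' (f := fun p : ℝ × ℝ => a p.1 p.2 ^ (2 : ℝ))
      (ha.pow_const _)).pow_const _
  have h1 : Measurable fun p : ℝ × ℝ × ℝ => a p.1 p.2.1 :=
    ha.comp (measurable_fst.prodMk measurable_snd.fst)
  have h2 : Measurable fun p : ℝ × ℝ × ℝ => a p.1 p.2.2 :=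
    ha.comp (measurable_fst.prodMk measurable_snd.snd)
  calc ∫⁻ t, (∫⁻ η, a t η) ^ 2 = ∫⁻ t, ∫⁻ p : ℝ × ℝ, a t p.1 * a t p.2 := by
        refine lintegral_congr fun t => ?_
        rw [Measure.volume_eq_prod, lintegral_prod_mul (hη t).aemeasurable (hη t).aemeasurable, sq]
    _ = ∫⁻ p : ℝ × ℝ, ∫⁻ t, a t p.1 * a t p.2 := lintegral_lintegral_swap (h1.mul h2).aemeasurable
    _ ≤ ∫⁻ p : ℝ × ℝ, T p.1 * T p.2 := lintegral_mono fun p => hCS p.1 p.2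
    _ = (∫⁻ η, T η) ^ 2 := by
        rw [Measure.volume_eq_prod, lintegral_prod_mul hTm.aemeasurable hTm.aemeasurable, sq]
    _ ≤ _ := by gcongr ?_ ^ 2; exact lintegral_mono_ae hroot

theorem measurable_parabolaExtension_slice {F : ℝ → ℝ → ℂ} (hF : Measurable (Function.uncurry F)) :
    Measurable fun p : (ℝ × ℝ) × ℝ => parabolaExtension (fun ξ => F ξ p.2) p.1.1 p.1.2 := by
  have h1 : Measurable fun q : ((ℝ × ℝ) × ℝ) × ℝ => F q.2 q.1.2 :=
    hF.comp (measurable_snd.prodMk measurable_fst.snd)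
  have h2 : Measurable fun q : ((ℝ × ℝ) × ℝ) × ℝ =>
      cexp (I * (q.1.1.2 * q.2 + (-q.1.1.1 : ℝ) * q.2 ^ 2)) * F q.2 q.1.2 :=
    Measurable.mul (by fun_prop) h1
  exact h2.stronglyMeasurable.integral_prod_right'.measurable

theorem lintegral_iSup_parabolaExtension_slice_le {F : ℝ → ℝ → ℂ}
    (hF : Measurable (Function.uncurry F)) (hFi : Integrable (Function.uncurry F)) :
    ∫⁻ t, (∫⁻ η, ⨆ q : ℚ, ‖parabolaExtension (fun ξ => F ξ η) t q‖ₑ ^ 2) ^ 2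
      ≤ (24 * ∫⁻ η, ∫⁻ ξ, ‖F ξ η‖ₑ ^ 2) ^ 2 := by
  rw [← lintegral_const_mul' _ _ (by norm_num)]
  refine lintegral_lintegral_sq_le ?_ ?_
  · refine Measurable.iSup fun q => ?_
    have h := (measurable_parabolaExtension_slice hF).comp
      ((measurable_fst.prodMk measurable_const).prodMk measurable_snd :
        Measurable fun p : ℝ × ℝ => ((p.1, (q : ℝ)), p.2))
    exact h.enorm.pow_const 2
  · filter_upwards [hFi.prod_left_ae] with η hη
    refine (lintegral_iSup_parabolaExtension_le hη).trans (le_of_eq ?_)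
    rw [mul_pow]; norm_num

theorem lintegral_parabolaExtension_slice_le_iSup {F : ℝ → ℝ → ℂ}
    (hFi : Integrable (Function.uncurry F)) (t x : ℝ) :
    ∫⁻ η, ‖parabolaExtension (fun ξ => F ξ η) t x‖ₑ ^ 2
      ≤ ∫⁻ η, ⨆ q : ℚ, ‖parabolaExtension (fun ξ => F ξ η) t q‖ₑ ^ 2 := by
  refine lintegral_mono_ae ?_
  filter_upwards [hFi.prod_left_ae] with η hη
  have hc : Continuous fun x : ℝ => ‖parabolaExtension (fun ξ => F ξ η) t x‖ₑ ^ 2 := by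
    have h := (continuous_parabolaExtension hη).comp (Continuous.prodMk_right t)
    exact (ENNReal.continuous_pow 2).comp h.enorm
  refine le_of_forall_lt fun c hcx => ?_
  obtain ⟨q, hq⟩ := Rat.denseRange_cast.exists_mem_open (hc.isOpen_preimage _ isOpen_Ioi) ⟨x, hcx⟩
  exact lt_of_lt_of_le hq (le_iSup (fun q : ℚ => ‖parabolaExtension (fun ξ => F ξ η) t q‖ₑ ^ 2) q)

theorem lintegral_lintegral_parabolaExtension_slice_le {F : ℝ → ℝ → ℂ}
    (hF : Measurable (Function.uncurry F)) (hFi : Integrable (Function.uncurry F)) (t : ℝ) :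
    ∫⁻ x, ∫⁻ η, ‖parabolaExtension (fun ξ => F ξ η) t x‖ₑ ^ 2
      ≤ ENNReal.ofReal (2 * π) * ∫⁻ η, ∫⁻ ξ, ‖F ξ η‖ₑ ^ 2 := by
  have hm := (measurable_parabolaExtension_slice hF).comp
    ((measurable_const.prodMk measurable_fst).prodMk measurable_snd :
      Measurable fun p : ℝ × ℝ => ((t, p.1), p.2))
  rw [lintegral_lintegral_swap (hm.enorm.pow_const 2).aemeasurable,
    ← lintegral_const_mul' _ _ ENNReal.ofReal_ne_top]
  refine lintegral_mono_ae ?_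
  filter_upwards [hFi.prod_left_ae] with η hη
  have hη' : Integrable fun ξ => F ξ η := hη
  have hn : ∀ ξ : ℝ, ‖cexp (I * ((-t : ℝ) * ξ ^ 2))‖ = 1 := fun ξ => by
    simpa using norm_cexp_phase 0 (-t) ξ
  have hg : Integrable fun ξ : ℝ => cexp (I * ((-t : ℝ) * ξ ^ 2)) * F ξ η :=
    hη'.bdd_mul (c := 1) (Measurable.aestronglyMeasurable (by fun_prop))
      (Filter.Eventually.of_forall fun ξ => (hn ξ).le)
  have h := lintegral_fourier_sq_le_s13 _ hg (fun a => a) fun _ _ => rfl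
  have hen : ∀ ξ : ℝ, ‖cexp (I * ((-t : ℝ) * ξ ^ 2)) * F ξ η‖ₑ = ‖F ξ η‖ₑ := fun ξ => by
    rw [enorm_mul, ← ofReal_norm, hn]; simp
  simp only [hen] at h
  refine le_trans (le_of_eq (lintegral_congr fun x => ?_)) h
  simp only [parabolaExtension]
  congr 3; ext ξ
  rw [← mul_assoc, ← Complex.exp_add]
  congr 2; ring

/-- The `L²(dy)` norm of the two-variable evolution is controlled by the evolution in `x` alone. -/
theorem lintegral_freeEvolution_sq_le {F : ℝ → ℝ → ℂ}
    (hFi : Integrable (Function.uncurry F)) (t x : ℝ) :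
    ∫⁻ y, ‖IFT2 (fun ξ η => cexp (-I * (t : ℂ) * ((ξ : ℂ) ^ 2 + (η : ℂ) ^ 2)) * F ξ η) x y‖ₑ ^ 2
      ≤ ∫⁻ η, ‖parabolaExtension (fun ξ => F ξ η) t x‖ₑ ^ 2 := by
  set c : ℂ := ((2 * (π : ℂ)) ^ 2)⁻¹ with hc
  set g : ℝ → ℂ := fun η =>
    cexp (I * ((-t : ℝ) * η ^ 2)) * parabolaExtension (fun ξ => F ξ η) t x with hg
  have hn : ∀ η : ℝ, ‖cexp (I * ((-t : ℝ) * η ^ 2))‖ = 1 := fun η => by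
    simpa using norm_cexp_phase 0 (-t) η
  have hphase : Integrable (Function.uncurry fun (ξ η : ℝ) =>
      cexp (I * (x * ξ + (-t : ℝ) * ξ ^ 2)) * F ξ η) :=
    hFi.bdd_mul (f := fun p : ℝ × ℝ => cexp (I * (x * p.1 + (-t : ℝ) * p.1 ^ 2))) (c := 1)
      (Measurable.aestronglyMeasurable (by fun_prop))
      (Filter.Eventually.of_forall fun p => (norm_cexp_phase _ _ _).le)
  have hgi : Integrable g :=
    (hphase.integral_prod_right).bdd_mul (c := 1) (Measurable.aestronglyMeasurable (by fun_prop))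
      (Filter.Eventually.of_forall fun η => (hn η).le)
  have hU : ∀ y : ℝ, IFT2 (fun ξ η => cexp (-I * (t : ℂ) * ((ξ : ℂ) ^ 2 + (η : ℂ) ^ 2)) * F ξ η) x y
      = c * ∫ η : ℝ, cexp (I * (η * y)) * g η := by
    intro y
    have hphase' : Integrable (Function.uncurry fun (ξ η : ℝ) =>
        cexp (I * (y * η + (-t : ℝ) * η ^ 2)) *
          (cexp (I * (x * ξ + (-t : ℝ) * ξ ^ 2)) * F ξ η)) :=
      hphase.bdd_mul (f := fun p : ℝ × ℝ => cexp (I * (y * p.2 + (-t : ℝ) * p.2 ^ 2))) (c := 1)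
        (Measurable.aestronglyMeasurable (by fun_prop))
        (Filter.Eventually.of_forall fun p => (norm_cexp_phase _ _ _).le)
    rw [IFT2, ← hc]
    congr 1
    calc _ = ∫ ξ : ℝ, ∫ η : ℝ, cexp (I * (y * η + (-t : ℝ) * η ^ 2)) *
          (cexp (I * (x * ξ + (-t : ℝ) * ξ ^ 2)) * F ξ η) := by
          congr 1; ext ξ; congr 1; ext η
          rw [← mul_assoc, ← mul_assoc, ← Complex.exp_add, ← Complex.exp_add]
          congr 2; push_cast; ring
      _ = ∫ η : ℝ, ∫ ξ : ℝ, cexp (I * (y * η + (-t : ℝ) * η ^ 2)) *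
          (cexp (I * (x * ξ + (-t : ℝ) * ξ ^ 2)) * F ξ η) := integral_integral_swap hphase'
      _ = _ := by
          congr 1; ext η
          rw [integral_const_mul, hg, ← mul_assoc, ← Complex.exp_add, parabolaExtension]
          congr 2; ring
  have hcn : ‖c‖ₑ ^ 2 * ENNReal.ofReal (2 * π) ≤ 1 := by
    have h1 : ‖c‖ = ((2 * π) ^ 2)⁻¹ := by
      rw [hc, norm_inv, norm_pow, norm_mul, Complex.norm_real, Real.norm_of_nonneg Real.pi_pos.le]
      norm_num
    rw [← ofReal_norm, h1, ← ENNReal.ofReal_pow (by positivity), ← ENNReal.ofReal_mul (by positivity),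
      ENNReal.ofReal_le_one]
    have h2 : 1 ≤ 2 * π := by linarith [Real.pi_gt_three]
    calc (((2 * π) ^ 2)⁻¹) ^ 2 * (2 * π) = ((2 * π) ^ 3)⁻¹ := by field_simp
      _ ≤ 1 := inv_le_one_of_one_le₀ (one_le_pow₀ h2)
  have h := lintegral_fourier_sq_le_s13 g hgi (fun a => a) fun _ _ => rfl
  have hen : ∀ η : ℝ, ‖g η‖ₑ = ‖parabolaExtension (fun ξ => F ξ η) t x‖ₑ := fun η => by
    rw [hg, enorm_mul, ← ofReal_norm, hn]; simp
  simp only [hen] at h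
  simp only [hU, enorm_mul, mul_pow]
  rw [lintegral_const_mul' _ _ (by simp)]
  calc _ ≤ ‖c‖ₑ ^ 2 * (ENNReal.ofReal (2 * π) *
        ∫⁻ η, ‖parabolaExtension (fun ξ => F ξ η) t x‖ₑ ^ 2) := by gcongr
    _ = (‖c‖ₑ ^ 2 * ENNReal.ofReal (2 * π)) *
        ∫⁻ η, ‖parabolaExtension (fun ξ => F ξ η) t x‖ₑ ^ 2 := by ring
    _ ≤ 1 * ∫⁻ η, ‖parabolaExtension (fun ξ => F ξ η) t x‖ₑ ^ 2 := by gcongr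
    _ = _ := one_mul _

theorem eLpNorm_toReal_le_lintegral_rpow {α : Type*} [MeasurableSpace α] {μ : Measure α}
    {f g : α → ℝ≥0∞} (hfg : ∀ a, f a ≤ g a) {p : ℝ} (hp : 0 < p) :
    eLpNorm (fun a => (f a).toReal) (ENNReal.ofReal p) μ ≤ (∫⁻ a, g a ^ p ∂μ) ^ (1 / p) := by
  rw [eLpNorm_eq_lintegral_rpow_enorm_toReal (by simpa using hp) ENNReal.ofReal_ne_top,
    ENNReal.toReal_ofReal hp.le]
  gcongr with a
  rw [Real.enorm_eq_ofReal ENNReal.toReal_nonneg]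
  exact ENNReal.ofReal_toReal_le.trans (hfg a)

theorem eLpNorm_toReal_top_le {α : Type*} [MeasurableSpace α] {μ : Measure α}
    {f : α → ℝ≥0∞} {c : ℝ≥0∞} (hf : ∀ a, f a ≤ c) :
    eLpNorm (fun a => (f a).toReal) ∞ μ ≤ c := by
  rw [eLpNorm_exponent_top]
  refine eLpNormEssSup_le_of_ae_enorm_bound (Filter.Eventually.of_forall fun a => ?_)
  rw [Real.enorm_eq_ofReal ENNReal.toReal_nonneg]
  exact ENNReal.ofReal_toReal_le.trans (hf a)

/-- Interpolation between a uniform-in-time `L²` bound and an `L⁴L^∞` bound, both expressed through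
a common quadratic density `Q`. -/
theorem eLpNorm_eLpNorm_toReal_le_of_admissible {k l : ℝ≥0∞} (hk : 2 < k) (hl : 2 ≤ l)
    (hadm : 2 / k + 1 / l = 1 / 2) {N Q : ℝ → ℝ → ℝ≥0∞} {P : ℝ → ℝ≥0∞} {B : ℝ≥0∞}
    (hN : ∀ t x, N t x ≤ Q t x ^ (1 / 2 : ℝ)) (hQ : ∀ t, Measurable (Q t)) (hPm : Measurable P)
    (hQP : ∀ t x, Q t x ≤ P t) (hQB : ∀ t, ∫⁻ x, Q t x ≤ B) (hP : ∫⁻ t, P t ^ 2 ≤ (24 * B) ^ 2) :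
    eLpNorm (fun t => (eLpNorm (fun x => (N t x).toReal) l volume).toReal) k volume
      ≤ (24 * B) ^ (1 / 2 : ℝ) := by
  have hB : B ≤ 24 * B := le_mul_of_one_le_left' (by norm_num)
  rcases eq_or_ne l ∞ with rfl | hl'
  · have hk4 : k = ENNReal.ofReal 4 := by
      simp only [ENNReal.div_top, add_zero] at hadm
      have hkt : k ≠ ∞ := by rintro rfl; simpa using hadm.symm
      rw [ENNReal.div_eq_div_iff (by simp) (by simp) (by positivity) hkt] at hadm
      rw [show (4 : ℝ) = ((4 : ℕ) : ℝ) by norm_num, ENNReal.ofReal_natCast]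
      calc k = k * 1 := (mul_one k).symm
        _ = 2 * 2 := hadm.symm
        _ = _ := by norm_num
    rw [hk4]
    refine (eLpNorm_toReal_le_lintegral_rpow (g := fun t => P t ^ (1 / 2 : ℝ))
      (fun t => eLpNorm_toReal_top_le fun x => (hN t x).trans
        (ENNReal.rpow_le_rpow (hQP t x) (by norm_num))) (by norm_num)).trans ?_
    have h2 : ∀ t, (P t ^ (1 / 2 : ℝ)) ^ (4 : ℝ) = P t ^ 2 := fun t => by
      rw [← ENNReal.rpow_mul, ← ENNReal.rpow_natCast]; norm_num
    simp only [h2]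
    calc _ ≤ ((24 * B) ^ 2) ^ (1 / 4 : ℝ) := by gcongr
      _ = _ := by rw [← ENNReal.rpow_natCast, ← ENNReal.rpow_mul]; norm_num
  set p : ℝ := l.toReal with hpdef
  have hlp : l = ENNReal.ofReal p := (ENNReal.ofReal_toReal hl').symm
  have hp2 : 2 ≤ p := by
    simpa using ENNReal.toReal_mono hl' hl
  have hp0 : 0 < p := by linarith
  have hinner : ∀ t, eLpNorm (fun x => (N t x).toReal) l volume
      ≤ (P t ^ (p / 2 - 1) * B) ^ (1 / p) := fun t => by
    rw [hlp]
    refine (eLpNorm_toReal_le_lintegral_rpow (hN t) hp0).trans ?_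
    gcongr
    calc ∫⁻ x, (Q t x ^ (1 / 2 : ℝ)) ^ p ≤ ∫⁻ x, P t ^ (p / 2 - 1) * Q t x := by
          refine lintegral_mono fun x => ?_
          have h1 : (Q t x ^ (1 / 2 : ℝ)) ^ p = Q t x ^ (p / 2 - 1) * Q t x ^ (1 : ℝ) := by
            rw [← ENNReal.rpow_mul, ← ENNReal.rpow_add_of_nonneg _ _ (by linarith) (by norm_num)]
            congr 1; ring
          simp only [h1, ENNReal.rpow_one]
          gcongr
          · linarith
          · exact hQP t x
      _ = P t ^ (p / 2 - 1) * ∫⁻ x, Q t x := lintegral_const_mul _ (hQ t)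
      _ ≤ _ := by gcongr; exact hQB t
  rcases eq_or_ne k ∞ with rfl | hk'
  · have hp : p = 2 := by
      have : l = 2 := by
        simpa using hadm
      simp [hpdef, this]
    refine eLpNorm_toReal_top_le fun t => (hinner t).trans ?_
    rw [hp]
    simp only [div_self (two_ne_zero' ℝ), sub_self, ENNReal.rpow_zero, one_mul]
    gcongr
  set r : ℝ := k.toReal with hrdef
  have hkr : k = ENNReal.ofReal r := (ENNReal.ofReal_toReal hk').symm
  have hr2 : 2 < r := by
    simpa using ENNReal.toReal_strict_mono hk' hk
  have hr0 : 0 < r := by linarith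
  have hpr : 2 / r + 1 / p = 1 / 2 := by
    have h := congrArg ENNReal.toReal hadm
    rw [ENNReal.toReal_add (ENNReal.div_ne_top (by simp) (by positivity))
      (ENNReal.div_ne_top (by simp) (by positivity))] at h
    simpa only [ENNReal.toReal_div, ENNReal.toReal_ofNat, ENNReal.toReal_one] using h
  have hexp : (p / 2 - 1) * (1 / p * r) = 2 := by
    field_simp at hpr ⊢
    nlinarith
  rw [hkr]
  refine (eLpNorm_toReal_le_lintegral_rpow hinner hr0).trans ?_
  have h3 : ∀ t, ((P t ^ (p / 2 - 1) * B) ^ (1 / p)) ^ r = P t ^ 2 * B ^ (1 / p * r) := fun t => by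
    rw [ENNReal.mul_rpow_of_nonneg _ _ (by positivity), ENNReal.mul_rpow_of_nonneg _ _ hr0.le,
      ← ENNReal.rpow_mul, ← ENNReal.rpow_mul, ← ENNReal.rpow_mul, hexp, ← ENNReal.rpow_natCast]
    norm_num
  simp only [h3]
  rw [lintegral_mul_const _ (hPm.pow_const 2)]
  calc _ ≤ ((24 * B) ^ 2 * (24 * B) ^ (1 / p * r)) ^ (1 / r) := by gcongr
    _ = _ := by
      rw [← ENNReal.rpow_natCast, ← ENNReal.rpow_add_of_nonneg _ _ (by norm_num) (by positivity),
        ← ENNReal.rpow_mul]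
      congr 1
      rw [← hpr]
      push_cast
      field_simp

/-- Bessel's inequality for the two-dimensional Fourier transform. -/
theorem lintegral_FT2_sq_le {f : ℝ → ℝ → ℂ} (hf : Measurable (Function.uncurry f))
    (hfi : Integrable (Function.uncurry f)) :
    ∫⁻ η, ∫⁻ ξ, ‖FT2 f ξ η‖ₑ ^ 2
      ≤ ENNReal.ofReal (2 * π) * (ENNReal.ofReal (2 * π) * ∫⁻ x, ∫⁻ y, ‖f x y‖ₑ ^ 2) := by
  set h : ℝ → ℝ → ℂ := fun x η => ∫ y : ℝ, cexp (I * ((-y : ℝ) * η)) * f x y with hh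
  have hn : ∀ a b : ℝ, ‖cexp (I * ((-a : ℝ) * b))‖ = 1 := fun a b => by
    simpa using norm_cexp_phase (-a) 0 b
  have hneg : ∀ a b : ℝ, |(-a) - (-b)| = |a - b| := fun a b => by
    rw [← abs_neg]; congr 1; ring
  have hhi : ∀ η, Integrable fun x => h x η := fun η => by
    refine Integrable.integral_prod_left (f := fun p : ℝ × ℝ => cexp (I * ((-p.2 : ℝ) * η)) * f p.1 p.2) ?_
    exact hfi.bdd_mul (f := fun p : ℝ × ℝ => cexp (I * ((-p.2 : ℝ) * η))) (c := 1)
      (Measurable.aestronglyMeasurable (by fun_prop))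
      (Filter.Eventually.of_forall fun p => (hn _ _).le)
  have hhm : Measurable (Function.uncurry h) := by
    refine StronglyMeasurable.measurable ?_
    refine StronglyMeasurable.integral_prod_right (E := ℂ)
      (f := fun (p : ℝ × ℝ) (y : ℝ) => cexp (I * ((-y : ℝ) * p.2)) * f p.1 y) ?_
    refine Measurable.stronglyMeasurable ?_
    have : Measurable fun q : (ℝ × ℝ) × ℝ => f q.1.1 q.2 :=
      hf.comp (measurable_fst.fst.prodMk measurable_snd)
    exact Measurable.mul (by fun_prop) this
  have hFT : ∀ ξ η, FT2 f ξ η = ∫ x : ℝ, cexp (I * ((-x : ℝ) * ξ)) * h x η := fun ξ η => by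
    rw [FT2]
    congr 1; ext x
    rw [hh, ← integral_const_mul]
    congr 1; ext y
    rw [← mul_assoc, ← Complex.exp_add]
    congr 2; push_cast; ring
  simp only [hFT]
  calc _ ≤ ∫⁻ η, ENNReal.ofReal (2 * π) * ∫⁻ x, ‖h x η‖ₑ ^ 2 :=
        lintegral_mono fun η => lintegral_fourier_sq_le_s13 _ (hhi η) (fun a => -a) hneg
    _ = ENNReal.ofReal (2 * π) * ∫⁻ x, ∫⁻ η, ‖h x η‖ₑ ^ 2 := by
        rw [lintegral_const_mul' _ _ ENNReal.ofReal_ne_top, lintegral_lintegral_swap]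
        exact ((hhm.comp measurable_swap).enorm.pow_const 2).aemeasurable
    _ ≤ ENNReal.ofReal (2 * π) * ∫⁻ x, ENNReal.ofReal (2 * π) * ∫⁻ y, ‖f x y‖ₑ ^ 2 := by
        refine mul_le_mul_right (lintegral_mono_ae ?_) _
        filter_upwards [hfi.prod_right_ae] with x hx
        exact lintegral_fourier_sq_le_s13 _ hx (fun a => -a) hneg
    _ = _ := by rw [lintegral_const_mul' _ _ ENNReal.ofReal_ne_top]

/-- The two-dimensional Fourier transform of a Schwartz function is, up to dilation, a Schwartz
function. -/
theorem exists_schwartz_FT2_eq (f : 𝓢(ℝ × ℝ, ℂ)) :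
    ∃ g : 𝓢(ℝ × ℝ, ℂ), ∀ ξ η, FT2 (fun a b => f (a, b)) ξ η = g ((2 * π)⁻¹ • (ξ, η)) := by
  set e := WithLp.prodContinuousLinearEquiv 2 ℝ ℝ ℝ
  set f' : 𝓢(WithLp 2 (ℝ × ℝ), ℂ) := SchwartzMap.compCLMOfContinuousLinearEquiv ℂ e f
  refine ⟨SchwartzMap.compCLMOfContinuousLinearEquiv ℂ e.symm (FourierTransform.fourier f'),
    fun ξ η => ?_⟩
  rw [SchwartzMap.compCLMOfContinuousLinearEquiv_apply, Function.comp_apply,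
    SchwartzMap.fourier_coe, Real.fourier_eq]
  have hi : Integrable (fun p : ℝ × ℝ => cexp (-I * ((ξ : ℂ) * p.1 + (η : ℂ) * p.2)) * f p) := by
    refine f.integrable.bdd_mul (c := 1) (Measurable.aestronglyMeasurable (by fun_prop))
      (Filter.Eventually.of_forall fun p => ?_)
    have := norm_cexp_phase (-(ξ * p.1 + η * p.2)) 0 1
    simp only [ofReal_neg, ofReal_add, ofReal_mul, ofReal_one, mul_one, ofReal_zero, zero_mul,
      add_zero] at this
    rw [show -I * ((ξ : ℂ) * p.1 + (η : ℂ) * p.2) = I * -((ξ : ℂ) * p.1 + (η : ℂ) * p.2) by ring]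
    exact this.le
  rw [FT2, ← integral_prod _ hi, ← Measure.volume_eq_prod,
    ← (WithLp.volume_preserving_ofLp ℝ ℝ).integral_comp
      (MeasurableEquiv.toLp 2 (ℝ × ℝ)).symm.measurableEmbedding]
  congr 1; ext v
  rw [Circle.smul_def, smul_eq_mul, Real.fourierChar_apply, WithLp.prod_inner_apply]
  congr 2
  have h1 : (e.symm ((2 * π)⁻¹ • (ξ, η))).ofLp = ((2 * π)⁻¹ * ξ, (2 * π)⁻¹ * η) := rfl
  have hpi : (π : ℂ) ≠ 0 := by exact_mod_cast Real.pi_ne_zero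
  rw [h1, RCLike.inner_apply, RCLike.inner_apply, conj_trivial, conj_trivial]
  push_cast
  field_simp

theorem continuous_FT2_schwartz (f : 𝓢(ℝ × ℝ, ℂ)) :
    Continuous (Function.uncurry (FT2 fun a b => f (a, b))) := by
  obtain ⟨g, hg⟩ := exists_schwartz_FT2_eq f
  have h : Function.uncurry (FT2 fun a b => f (a, b)) = fun p => g ((2 * π)⁻¹ • p) :=
    funext fun p => hg p.1 p.2
  rw [h]
  exact g.continuous.comp (continuous_const_smul _)

theorem integrable_FT2_schwartz (f : 𝓢(ℝ × ℝ, ℂ)) :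
    Integrable (Function.uncurry (FT2 fun a b => f (a, b))) := by
  obtain ⟨g, hg⟩ := exists_schwartz_FT2_eq f
  have h : Function.uncurry (FT2 fun a b => f (a, b)) = fun p => g ((2 * π)⁻¹ • p) :=
    funext fun p => hg p.1 p.2
  rw [h]
  exact g.integrable.comp_smul (inv_ne_zero (by positivity))

theorem measurable_lintegral_parabolaExtension_slice {F : ℝ → ℝ → ℂ}
    (hF : Measurable (Function.uncurry F)) (t : ℝ) :
    Measurable fun x => ∫⁻ η, ‖parabolaExtension (fun ξ => F ξ η) t x‖ₑ ^ 2 := by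
  refine Measurable.lintegral_prod_right'
    (f := fun p : ℝ × ℝ => ‖parabolaExtension (fun ξ => F ξ p.2) t p.1‖ₑ ^ 2) ?_
  have h := ((measurable_parabolaExtension_slice hF).enorm.pow_const 2).comp
    ((measurable_const.prodMk measurable_fst).prodMk measurable_snd :
      Measurable fun p : ℝ × ℝ => ((t, p.1), p.2))
  simpa only [Function.comp_def] using h

theorem measurable_lintegral_iSup_parabolaExtension_slice {F : ℝ → ℝ → ℂ}
    (hF : Measurable (Function.uncurry F)) :
    Measurable fun t => ∫⁻ η, ⨆ q : ℚ, ‖parabolaExtension (fun ξ => F ξ η) t q‖ₑ ^ 2 := by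
  refine Measurable.lintegral_prod_right'
    (f := fun p : ℝ × ℝ => ⨆ q : ℚ, ‖parabolaExtension (fun ξ => F ξ p.2) p.1 q‖ₑ ^ 2)
    (Measurable.iSup fun q => ?_)
  have h := ((measurable_parabolaExtension_slice hF).enorm.pow_const 2).comp
    ((measurable_fst.prodMk measurable_const).prodMk measurable_snd :
      Measurable fun p : ℝ × ℝ => ((p.1, (q : ℝ)), p.2))
  simpa only [Function.comp_def] using h

/-- Non-endpoint Strichartz estimate for the free two-variable Schrödinger flow. -/
theorem strichartz_free_lambda (k l : ℝ≥0∞) (hk : 2 < k) (hl : 2 ≤ l)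
    (hadm : 2 / k + 1 / l = 1 / 2) :
    ∃ C : ℝ, 0 < C ∧ ∀ Λ₀ : 𝓢(ℝ × ℝ, ℂ),
      MixedN3 volume k l 2 (freeLambda (fun a b => Λ₀ (a, b)))
        ≤ ENNReal.ofReal C * L2K (fun a b => Λ₀ (a, b)) := by
  refine ⟨(24 * (2 * π) ^ 3) ^ (1 / 2 : ℝ), by positivity, fun Λ₀ => ?_⟩
  set F : ℝ → ℝ → ℂ := FT2 fun a b => Λ₀ (a, b)
  have hF : Measurable (Function.uncurry F) := (continuous_FT2_schwartz Λ₀).measurable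
  have hFi : Integrable (Function.uncurry F) := integrable_FT2_schwartz Λ₀
  have heLp : ∀ {α : Type} [MeasurableSpace α] (μ : Measure α) (g : α → ℂ),
      eLpNorm g 2 μ = (∫⁻ a, ‖g a‖ₑ ^ 2 ∂μ) ^ (1 / 2 : ℝ) := fun μ g => by
    rw [eLpNorm_eq_lintegral_rpow_enorm_toReal (by simp) (by simp)]
    simp
  set S : ℝ≥0∞ := ∫⁻ η, ∫⁻ ξ, ‖F ξ η‖ₑ ^ 2
  have hpi : 1 ≤ ENNReal.ofReal (2 * π) := by
    rw [ENNReal.one_le_ofReal]; linarith [Real.pi_gt_three]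
  have hmain : MixedN3 volume k l 2 (freeLambda (fun a b => Λ₀ (a, b)))
      ≤ (24 * (ENNReal.ofReal (2 * π) * S)) ^ (1 / 2 : ℝ) := by
    refine eLpNorm_eLpNorm_toReal_le_of_admissible hk hl hadm
      (Q := fun t x => ∫⁻ η, ‖parabolaExtension (fun ξ => F ξ η) t x‖ₑ ^ 2)
      (P := fun t => ∫⁻ η, ⨆ q : ℚ, ‖parabolaExtension (fun ξ => F ξ η) t q‖ₑ ^ 2)
      (fun t x => ?_) (measurable_lintegral_parabolaExtension_slice hF)
      (measurable_lintegral_iSup_parabolaExtension_slice hF)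
      (lintegral_parabolaExtension_slice_le_iSup hFi)
      (lintegral_lintegral_parabolaExtension_slice_le hF hFi)
      ((lintegral_iSup_parabolaExtension_slice_le hF hFi).trans ?_)
    · rw [heLp]
      exact ENNReal.rpow_le_rpow (lintegral_freeEvolution_sq_le hFi t x) (by norm_num)
    · gcongr
      exact le_mul_of_one_le_left' hpi
  have hbessel : S ≤ _ := lintegral_FT2_sq_le (f := fun a b => Λ₀ (a, b)) Λ₀.continuous.measurable
    Λ₀.integrable
  have hL : L2K (fun a b => Λ₀ (a, b)) = (∫⁻ x, ∫⁻ y, ‖Λ₀ (x, y)‖ₑ ^ 2) ^ (1 / 2 : ℝ) := by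
    rw [L2K, heLp, Measure.volume_eq_prod,
      lintegral_prod _ (Λ₀.continuous.measurable.enorm.pow_const 2).aemeasurable]
  rw [hL, ← ENNReal.ofReal_rpow_of_nonneg (by positivity) (by norm_num),
    ← ENNReal.mul_rpow_of_nonneg _ _ (by norm_num)]
  refine hmain.trans (ENNReal.rpow_le_rpow ?_ (by norm_num))
  rw [ENNReal.ofReal_mul (p := 24) (by norm_num), ENNReal.ofReal_pow (by positivity), ENNReal.ofReal_ofNat]
  calc 24 * (ENNReal.ofReal (2 * π) * S)
      ≤ 24 * (ENNReal.ofReal (2 * π) * (ENNReal.ofReal (2 * π) *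
        (ENNReal.ofReal (2 * π) * ∫⁻ x, ∫⁻ y, ‖Λ₀ (x, y)‖ₑ ^ 2))) := by gcongr
    _ = _ := by ring

end
end
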